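/- Let m ≥ 1 and j ≥ 2 be integers, let E = (e_{i,ℓ}) ∈ ℝ^{(m+j)×j}, and let U ∈ ℝ^{(m+j)×(j+1)} have i-th row (u_{i,0}, u_{i,1}, …, u_{i,j}); write u_i := (u_{i,1},…,u_{i,j}) ∈ ℝ^j. Let Δ := {y ∈ ℝ^j : u_{i,0} + u_i·y > 0 for all i ∈ {1,…,m+j}}, and define H : Δ → ℝ^j by H_ℓ(y) := Π_{i=1}^{m+j} (u_{i,0} + u_i·y)^{e_{i,ℓ}} − 1 for ℓ = 1,…,j (real powers of positive bases). Then the set of non-degenerate roots of H in Δ (points y ∈ Δ with H(y) = 0 at which the Jacobian matrix of H is invertible) is finite and has cardinality strictly less than S(m,j) = ((e²+3)/4)·2^{j(j−1)/2}·m^j. -/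

import Mathlib

/-- The fewnomial-type bound `S(m,j) = ((e²+3)/4)·2^{j(j−1)/2}·mʲ` for `j ≥ 2`
(with `S(m,0) = 1` and `S(m,1) = m+1`). -/
noncomputable def S (m j : ℕ) : ℝ :=
  if j = 0 then 1
  else if j = 1 then (m : ℝ) + 1
  else ((Real.exp 1) ^ 2 + 3) / 4 * (2 : ℝ) ^ (j * (j - 1) / 2) * (m : ℝ) ^ j


namespace Gale
open Set Filter Topology MeasureTheory

/-- real induction -/
theorem real_induction (A : Set ℝ) (h0 : (0:ℝ) ∈ A)
    (hr : ∀ s, 0 ≤ s → s ∈ A → ∃ δ > 0, ∀ t, s ≤ t → t < s + δ → t ∈ A)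
    (hl : ∀ s, 0 < s → (∀ t, 0 ≤ t → t < s → t ∈ A) → s ∈ A) :
    ∀ s, 0 ≤ s → s ∈ A := by
  intro s hs
  by_contra hsA
  set B : Set ℝ := {t | 0 ≤ t ∧ t ∉ A} with hB
  have hBne : B.Nonempty := ⟨s, hs, hsA⟩
  have hBbd : BddBelow B := ⟨0, fun t ht => ht.1⟩
  set m := sInf B with hm
  have hm0 : 0 ≤ m := le_csInf hBne fun t ht => ht.1
  have hlt : ∀ t, 0 ≤ t → t < m → t ∈ A := by
    intro t ht htm
    by_contra h
    exact absurd (csInf_le hBbd (show t ∈ B from ⟨ht, h⟩)) (not_le.mpr htm)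
  have hmA : m ∈ A := by
    rcases hm0.eq_or_lt with h | h
    · rw [← h]; exact h0
    · exact hl m h hlt
  obtain ⟨δ, hδ, hd⟩ := hr m hm0 hmA
  obtain ⟨t, htB, ht⟩ := exists_lt_of_csInf_lt hBne (show sInf B < m + δ by linarith)
  exact htB.2 (hd t (csInf_le hBbd htB) ht)

/-- sweeping lemma, one direction -/
theorem sweep_pos {α : Type*} [MetricSpace α] (X : Set α) (hX : IsCompact X)
    (f : α → ℝ) (hf : ContinuousOn f X) (Bd : Finset α)
    (hinj : ∀ x ∈ X, ∃ U ∈ 𝓝 x, InjOn f (X ∩ U))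
    (hop : ∀ x ∈ X, x ∉ Bd → ∀ U ∈ 𝓝 x, ∀ᶠ s in 𝓝 (f x), ∃ y ∈ X ∩ U, f y = s)
    (Z : Finset α) (hZ : ∀ z ∈ Z, z ∈ X ∧ z ∉ Bd ∧ f z = 0) :
    Z.card ≤ (Bd.filter fun x => 0 < f x).card := by
  classical
  set A : Set ℝ := {s | ∃ g : Z → α, Function.Injective g ∧ ∀ z, g z ∈ X ∧
    ((g z ∉ Bd ∧ f (g z) = s) ∨ (g z ∈ Bd ∧ 0 < f (g z) ∧ f (g z) ≤ s))} with hA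
  have key : ∀ s, 0 ≤ s → s ∈ A := by
    apply real_induction
    · exact ⟨fun z => z, Subtype.val_injective, fun z => ⟨(hZ z z.2).1, Or.inl (hZ z z.2).2⟩⟩
    · rintro s hs ⟨g, hg, hgz⟩
      obtain ⟨U, hU, hUd⟩ := (Set.toFinite (range g)).t2_separation
      have hev : ∀ z : Z, ∀ᶠ t in 𝓝 s, ∃ y, y ∈ X ∧ y ∈ U (g z) ∧ (s ≤ t → 
          ((y ∉ Bd ∧ f y = t) ∨ (y ∈ Bd ∧ 0 < f y ∧ f y ≤ t))) := by
        intro z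
        obtain ⟨hzX, h | h⟩ := hgz z
        · have hnb : U (g z) ∩ ((Bd : Set α))ᶜ ∈ 𝓝 (g z) := by
            apply Filter.inter_mem ((hU (g z)).2.mem_nhds (hU (g z)).1)
            exact (Bd.finite_toSet.isClosed.isOpen_compl).mem_nhds (by simpa using h.1)
          have := hop (g z) hzX h.1 _ hnb
          rw [h.2] at this
          filter_upwards [this] with t ht
          obtain ⟨y, ⟨hyX, hyU, hyB⟩, hy⟩ := ht
          exact ⟨y, hyX, hyU, fun _ => Or.inl ⟨by simpa using hyB, hy⟩⟩
        · refine Filter.Eventually.of_forall fun t => ⟨g z, hzX, (hU (g z)).1, fun hst => Or.inr ⟨h.1, h.2.1, h.2.2.trans hst⟩⟩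
      have hall := Filter.eventually_all.mpr hev
      obtain ⟨δ, hδ, hball⟩ := Metric.eventually_nhds_iff.mp hall
      refine ⟨δ, hδ, fun t hst htd => ?_⟩
      have ht := hball (y := t) (by rw [Real.dist_eq, abs_of_nonneg (by linarith)]; linarith)
      choose y hyX hyU hy using ht
      refine ⟨y, ?_, fun z => ⟨hyX z, hy z hst⟩⟩
      intro z z' hzz
      by_contra hne
      have hd := hUd (mem_range_self z) (mem_range_self z') (fun h => hne (hg h))
      exact Set.disjoint_left.mp hd (hyU z) (hzz ▸ hyU z')
    · intro s hs hall
      set sq : ℕ → ℝ := fun n => s - s / (n + 2) with hsq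
      have hsq1 : ∀ n, sq n < s := fun n => by
        have : 0 < s / ((n:ℝ) + 2) := by positivity
        simp only [hsq]; linarith
      have hsq0 : ∀ n, 0 ≤ sq n := fun n => by
        have : s / ((n:ℝ) + 2) ≤ s := div_le_self hs.le (by linarith [(Nat.cast_nonneg n : (0:ℝ) ≤ n)])
        simp only [hsq]; linarith
      have hsqt : Tendsto sq atTop (𝓝 s) := by
        have h1 : Tendsto (fun n : ℕ => s / ((n:ℝ) + 2)) atTop (𝓝 0) := by
          apply Tendsto.div_atTop tendsto_const_nhds
          exact tendsto_atTop_add_const_right _ _ tendsto_natCast_atTop_atTop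
        simpa using (tendsto_const_nhds (x := s)).sub h1
      choose g hgi hgz using fun n => hall (sq n) (hsq0 n) (hsq1 n)
      have hcomp : IsCompact (Set.pi univ (fun _ : Z => X)) := isCompact_univ_pi fun _ => hX
      obtain ⟨gl, hgl, φ, hφ, hlim⟩ := hcomp.tendsto_subseq (x := g) (fun n z _ => (hgz n z).1)
      rw [tendsto_pi_nhds] at hlim
      have hglX : ∀ z, gl z ∈ X := fun z => hgl z (mem_univ _)
      have hst : Tendsto (fun n => sq (φ n)) atTop (𝓝 s) := hsqt.comp hφ.tendsto_atTop
      have hft : ∀ z, Tendsto (fun n => f (g (φ n) z)) atTop (𝓝 (f (gl z))) := by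
        intro z
        have := hf (gl z) (hglX z)
        apply Tendsto.comp this
        rw [tendsto_nhdsWithin_iff]
        exact ⟨hlim z, Filter.Eventually.of_forall fun n => (hgz _ z).1⟩
      have hfs : ∀ z, f (gl z) ≤ s := by
        intro z
        apply le_of_tendsto (hft z)
        refine Filter.Eventually.of_forall fun n => ?_
        rcases (hgz (φ n) z).2 with h | h
        · exact h.2.le.trans (hsq1 _).le
        · exact h.2.2.trans (hsq1 _).le
      have hBdev : ∀ z, ∀ᶠ n in atTop, g (φ n) z ∈ Bd → g (φ n) z = gl z := by
        intro z
        have : ((Bd.erase (gl z) : Finset α) : Set α)ᶜ ∈ 𝓝 (gl z) :=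
          ((Bd.erase (gl z)).finite_toSet.isClosed.isOpen_compl).mem_nhds (by simp)
        filter_upwards [hlim z this] with n hn hb
        by_contra hne
        exact hn (by simp [hne, hb])
      -- dichotomy
      have h1 : ∀ z, f (gl z) ≠ s → ∀ᶠ n in atTop, g (φ n) z ∈ Bd ∧ 0 < f (g (φ n) z) ∧ g (φ n) z = gl z := by
        intro z hne
        have hev : ∀ᶠ n in atTop, f (g (φ n) z) ≠ sq (φ n) := by
          have := ((hft z).sub hst).eventually_ne (sub_ne_zero.mpr hne)
          filter_upwards [this] with n hn
          exact sub_ne_zero.mp hn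
        filter_upwards [hev, hBdev z] with n hn hb
        rcases (hgz (φ n) z).2 with h | h
        · exact absurd h.2 hn
        · exact ⟨h.1, h.2.1, hb h.1⟩
      have h2 : ∀ z, f (gl z) = s → ∀ᶠ n in atTop, f (g (φ n) z) = sq (φ n) := by
        intro z he
        filter_upwards [hBdev z] with n hb
        rcases (hgz (φ n) z).2 with h | h
        · exact h.2
        · exfalso
          have := h.2.2
          rw [hb h.1, he] at this
          exact absurd this (not_le.mpr (hsq1 _))
      refine ⟨gl, ?_, fun z => ⟨hglX z, ?_⟩⟩
      · intro z z' hzz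
        by_contra hne
        by_cases he : f (gl z) = s
        · obtain ⟨U, hU, hUi⟩ := hinj (gl z) (hglX z)
          have e1 : ∀ᶠ n in atTop, g (φ n) z ∈ U := hlim z hU
          have e2 : ∀ᶠ n in atTop, g (φ n) z' ∈ U := hlim z' (hzz ▸ hU)
          have := (((h2 z he).and (h2 z' (hzz ▸ he))).and (e1.and e2)).exists
          obtain ⟨n, ⟨a1, a2⟩, a3, a4⟩ := this
          exact hne (hgi (φ n) (hUi ⟨(hgz _ z).1, a3⟩ ⟨(hgz _ z').1, a4⟩ (a1.trans a2.symm)))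
        · obtain ⟨n, a1, a2⟩ := ((h1 z he).and (h1 z' (hzz ▸ he))).exists
          exact hne (hgi (φ n) (a1.2.2.trans (hzz.trans a2.2.2.symm)))
      · by_cases he : f (gl z) = s
        · by_cases hb : gl z ∈ Bd
          · exact Or.inr ⟨hb, he ▸ hs, he.le⟩
          · exact Or.inl ⟨hb, he⟩
        · obtain ⟨n, a1, a2, a3⟩ := (h1 z he).exists
          rw [a3] at a1 a2
          exact Or.inr ⟨a1, a2, hfs z⟩
  obtain ⟨M, hM⟩ := hX.bddAbove_image hf
  obtain ⟨g, hgi, hg⟩ := key (max M 0 + 1) (by positivity)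
  have hg' : ∀ z, g z ∈ Bd.filter fun x => 0 < f x := by
    intro z
    rw [Finset.mem_filter]
    rcases (hg z).2 with h | h
    · exfalso
      have : f (g z) ≤ M := hM (mem_image_of_mem f (hg z).1)
      have h3 := le_max_left M 0
      linarith [h.2]
    · exact ⟨h.1, h.2.1⟩
  have := Finset.card_le_card_of_injOn (s := (Finset.univ : Finset Z)) g (fun z _ => hg' z) hgi.injOn
  simpa using this

theorem sweep {α : Type*} [MetricSpace α] (X : Set α) (hX : IsCompact X)
    (f : α → ℝ) (hf : ContinuousOn f X) (Bd : Finset α)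
    (hinj : ∀ x ∈ X, ∃ U ∈ 𝓝 x, InjOn f (X ∩ U))
    (hop : ∀ x ∈ X, x ∉ Bd → ∀ U ∈ 𝓝 x, ∀ᶠ s in 𝓝 (f x), ∃ y ∈ X ∩ U, f y = s)
    (Z : Finset α) (hZ : ∀ z ∈ Z, z ∈ X ∧ z ∉ Bd ∧ f z = 0) :
    2 * Z.card ≤ Bd.card := by
  classical
  have h1 := sweep_pos X hX f hf Bd hinj hop Z hZ
  have h2 := sweep_pos X hX (fun x => - f x) hf.neg Bd
    (fun x hx => by
      obtain ⟨U, hU, hi⟩ := hinj x hx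
      exact ⟨U, hU, fun a ha b hb hab => hi ha hb (neg_injective hab)⟩)
    (fun x hx hb U hU => by
      have := hop x hx hb U hU
      have hc : Tendsto (fun s : ℝ => -s) (𝓝 (-f x)) (𝓝 (f x)) := by
        simpa using (continuous_neg.tendsto (-f x))
      filter_upwards [hc this] with s hs
      obtain ⟨y, hy, hfy⟩ := hs
      exact ⟨y, hy, by rw [hfy]; simp⟩)
    Z (fun z hz => ⟨(hZ z hz).1, (hZ z hz).2.1, by simp [(hZ z hz).2.2]⟩)
  have hdis : Disjoint (Bd.filter fun x => 0 < f x) (Bd.filter fun x => 0 < - f x) := by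
    rw [Finset.disjoint_filter]
    intro x _ h1 h2
    linarith
  have := Finset.card_le_card (Finset.union_subset (Finset.filter_subset (fun x => 0 < f x) Bd) (Finset.filter_subset (fun x => 0 < - f x) Bd))
  rw [Finset.card_union_of_disjoint hdis] at this
  omega

end Gale


namespace Gale
open Set Filter Topology MeasureTheory

theorem local_inj {E : Type*} [NormedAddCommGroup E] [NormedSpace ℝ E] [FiniteDimensional ℝ E]
    {F : E → E} {x : E} (hF : ContDiffAt ℝ 1 F x)
    (hi : Function.Injective (fderiv ℝ F x)) :
    (∃ U ∈ 𝓝 x, InjOn F U) ∧ map F (𝓝 x) = 𝓝 (F x) := by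
  have : CompleteSpace E := FiniteDimensional.complete ℝ E
  let e : E ≃L[ℝ] E := (LinearEquiv.ofInjectiveEndo (fderiv ℝ F x : E →ₗ[ℝ] E) hi).toContinuousLinearEquiv
  have he : (e : E →L[ℝ] E) = fderiv ℝ F x := by ext v; rfl
  have hs : HasStrictFDerivAt F (e : E →L[ℝ] E) x := by
    rw [he]; exact hF.hasStrictFDerivAt one_ne_zero
  refine ⟨⟨(hs.toOpenPartialHomeomorph F).source, ?_, ?_⟩, hs.map_nhds_eq_of_equiv⟩
  · exact (hs.toOpenPartialHomeomorph F).open_source.mem_nhds hs.mem_toOpenPartialHomeomorph_source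
  · exact (hs.toOpenPartialHomeomorph F).injOn

theorem ev_inj {E : Type*} [NormedAddCommGroup E] [NormedSpace ℝ E] [FiniteDimensional ℝ E]
    {F : E → E} {x : E} (hF : ContDiffAt ℝ 1 F x)
    (hi : Function.Injective (fderiv ℝ F x)) :
    ∀ᶠ y in 𝓝 x, Function.Injective (fderiv ℝ F y) := by
  have hc : ContinuousAt (fderiv ℝ F) x := hF.continuousAt_fderiv one_ne_zero
  have h1 : ∀ A : E →L[ℝ] E, Function.Injective A ↔ A.det ≠ 0 := by
    intro A
    constructor
    · intro h
      have : (LinearMap.det (A : E →ₗ[ℝ] E)) ≠ 0 := by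
        have h2 : (A : E →ₗ[ℝ] E).ker = ⊥ := LinearMap.ker_eq_bot.mpr h
        intro h3
        exact (LinearMap.bot_lt_ker_of_det_eq_zero h3).ne' h2
      exact this
    · intro h
      have h2 : IsUnit (A : E →ₗ[ℝ] E) := by
        rw [LinearMap.isUnit_iff_isUnit_det]
        exact isUnit_iff_ne_zero.mpr h
      exact LinearMap.ker_eq_bot.mp (((A : E →ₗ[ℝ] E).isUnit_iff_ker_eq_bot).mp h2)
  simp only [h1] at hi ⊢
  exact (ContinuousLinearMap.continuous_det.continuousAt.comp hc).eventually_ne hi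

theorem persist {E : Type*} [NormedAddCommGroup E] [NormedSpace ℝ E] [FiniteDimensional ℝ E]
    (D : Set E) (hD : IsOpen D) (F : E → E) (hF : ∀ x ∈ D, ContDiffAt ℝ 1 F x) (Z : Finset E) (v0 : E)
    (hZ : ∀ z ∈ Z, z ∈ D ∧ F z = v0 ∧ Function.Injective (fderiv ℝ F z)) :
    ∀ᶠ v in 𝓝 v0, ∃ Z' : Finset E, Z'.card = Z.card ∧
      ∀ z ∈ Z', z ∈ D ∧ F z = v ∧ Function.Injective (fderiv ℝ F z) := by
  classical
  obtain ⟨U, hU, hUd⟩ := (Z.finite_toSet).t2_separation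
  have hev : ∀ z : Z, ∀ᶠ v in 𝓝 v0, ∃ y, y ∈ U z ∧ y ∈ D ∧ F y = v ∧ Function.Injective (fderiv ℝ F y) := by
    rintro ⟨z, hz⟩
    obtain ⟨hzD, hz0, hzi⟩ := hZ z hz
    have h1 := (local_inj (hF z hzD) hzi).2
    have h2 : {y | y ∈ U z ∧ y ∈ D ∧ Function.Injective (fderiv ℝ F y)} ∈ 𝓝 z :=
      Filter.inter_mem ((hU z).2.mem_nhds (hU z).1) (Filter.inter_mem (hD.mem_nhds hzD) (ev_inj (hF z hzD) hzi))
    have h3 := image_mem_map (m := F) h2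
    rw [h1, hz0] at h3
    filter_upwards [h3] with v hv
    obtain ⟨y, hy, hyv⟩ := hv
    exact ⟨y, hy.1, hy.2.1, hyv, hy.2.2⟩
  filter_upwards [Filter.eventually_all.mpr hev] with v hv
  choose y hyU hyD hyF hyi using hv
  have hinj : Function.Injective y := by
    intro z z' hzz
    by_contra hne
    have hd := hUd z.2 z'.2 (fun h => hne (Subtype.ext h))
    exact Set.disjoint_left.mp hd (hyU z) (hzz ▸ hyU z')
  refine ⟨Finset.univ.image y, ?_, ?_⟩
  · rw [Finset.card_image_of_injective _ hinj]; simp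
  · intro z hz
    obtain ⟨w, _, rfl⟩ := Finset.mem_image.mp hz
    exact ⟨hyD w, hyF w, hyi w⟩

theorem sard {k : ℕ} (r : Fin (k+1)) (D : Set (Fin (k+1) → ℝ))
    (Φ : (Fin (k+1) → ℝ) → (Fin (k+1) → ℝ)) (hΦ : ∀ x ∈ D, ContDiffAt ℝ 1 Φ x) :
    ∀ᵐ a : Fin k → ℝ, ∀ᵐ s : ℝ, ∀ x ∈ D, Φ x = r.insertNth s a → Function.Injective (fderiv ℝ Φ x) := by
  set C : Set (Fin (k+1) → ℝ) := {x | x ∈ D ∧ ¬ Function.Injective (fderiv ℝ Φ x)} with hC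
  have h0 : volume (Φ '' C) = 0 := by
    apply addHaar_image_eq_zero_of_det_fderivWithin_eq_zero (f' := fderiv ℝ Φ) volume
    · intro x hx
      exact (((hΦ x hx.1).differentiableAt one_ne_zero).hasFDerivAt).hasFDerivWithinAt
    · intro x hx
      by_contra h
      apply hx.2
      have h2 : IsUnit (fderiv ℝ Φ x : (Fin (k+1) → ℝ) →ₗ[ℝ] (Fin (k+1) → ℝ)) := by
        rw [LinearMap.isUnit_iff_isUnit_det]
        exact isUnit_iff_ne_zero.mpr h
      exact LinearMap.ker_eq_bot.mp (((fderiv ℝ Φ x : (Fin (k+1) → ℝ) →ₗ[ℝ] (Fin (k+1) → ℝ)).isUnit_iff_ker_eq_bot).mp h2)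
  have h1 : ∀ᵐ y : Fin (k+1) → ℝ, y ∉ Φ '' C := measure_eq_zero_iff_ae_notMem.mp h0
  have mp := (volume_preserving_piFinSuccAbove (fun _ : Fin (k+1) => ℝ) r).symm
  have h2 := mp.quasiMeasurePreserving.ae h1
  have h3 := (Measure.measurePreserving_swap (μ := (volume : Measure (Fin k → ℝ))) (ν := (volume : Measure ℝ))).quasiMeasurePreserving.ae h2
  have h4 := Measure.ae_ae_of_ae_prod h3
  filter_upwards [h4] with a ha
  filter_upwards [ha] with s hs x hx hxs
  by_contra hni
  exact hs ⟨x, ⟨hx, hni⟩, hxs⟩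

theorem finite_of_bdd {α : Type*} (S : Set α) (B : ℝ) (h : ∀ Y : Finset α, (∀ x ∈ Y, x ∈ S) → (Y.card : ℝ) ≤ B) :
    S.Finite := by
  by_contra hinf
  obtain ⟨Y, hY, hc⟩ := Set.Infinite.exists_subset_card_eq hinf (⌊B⌋₊ + 1)
  have := h Y (fun x hx => hY hx)
  rw [hc] at this
  have h2 := Nat.lt_floor_add_one B
  push_cast at this
  linarith

/-- replace the `r`-th component of `F` by `Q`. -/
def upd {k : ℕ} {α : Type*} (F : α → (Fin (k+1) → ℝ)) (r : Fin (k+1)) (Q : α → ℝ) : α → (Fin (k+1) → ℝ) :=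
  fun x => r.insertNth (Q x) (fun l => F x (r.succAbove l))

theorem upd_same {k : ℕ} {α : Type*} (F : α → (Fin (k+1) → ℝ)) (r : Fin (k+1)) (Q : α → ℝ) (x : α) :
    upd F r Q x r = Q x := by simp [upd]

theorem upd_succAbove {k : ℕ} {α : Type*} (F : α → (Fin (k+1) → ℝ)) (r : Fin (k+1)) (Q : α → ℝ) (x : α) (l : Fin k) :
    upd F r Q x (r.succAbove l) = F x (r.succAbove l) := by simp [upd]

theorem upd_eq_iff {k : ℕ} {α : Type*} (F : α → (Fin (k+1) → ℝ)) (r : Fin (k+1)) (Q : α → ℝ) (x : α) (s : ℝ)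
    (a : Fin k → ℝ) :
    upd F r Q x = r.insertNth s a ↔ Q x = s ∧ ∀ l, F x (r.succAbove l) = a l := by
  constructor
  · intro h
    refine ⟨?_, fun l => ?_⟩
    · have := congrFun h r
      simpa [upd] using this
    · have := congrFun h (r.succAbove l)
      simpa [upd] using this
  · rintro ⟨h1, h2⟩
    funext l
    rcases Fin.eq_self_or_eq_succAbove r l with rfl | ⟨j, rfl⟩
    · simp [upd, h1]
    · simp [upd, h2]

theorem eq_insertNth_iff {k : ℕ} (r : Fin (k+1)) (v : Fin (k+1) → ℝ) (s : ℝ)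
    (a : Fin k → ℝ) : v = r.insertNth s a ↔ v r = s ∧ ∀ l, v (r.succAbove l) = a l := by
  constructor
  · rintro rfl; simp
  · rintro ⟨h1, h2⟩
    funext l
    rcases Fin.eq_self_or_eq_succAbove r l with rfl | ⟨j, rfl⟩
    · simp [h1]
    · simp [h2]

theorem upd_contDiffAt {k : ℕ} {E : Type*} [NormedAddCommGroup E] [NormedSpace ℝ E] 
    (F : E → (Fin (k+1) → ℝ)) (r : Fin (k+1)) (Q : E → ℝ) (x : E)
    (hF : ContDiffAt ℝ 1 F x) (hQ : ContDiffAt ℝ 1 Q x) : ContDiffAt ℝ 1 (upd F r Q) x := by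
  rw [contDiffAt_pi]
  intro l
  rcases Fin.eq_self_or_eq_succAbove r l with rfl | ⟨j, rfl⟩
  · simpa [upd] using hQ
  · simp only [upd, Fin.insertNth_apply_succAbove]
    exact (contDiffAt_pi.mp hF) _

theorem exists_gen {P : ℝ → Prop} (h : ∀ᵐ s : ℝ, P s) (a b : ℝ) (hab : a < b) : ∃ s, a < s ∧ s < b ∧ P s := by
  have hd : Dense {s | P s} := Measure.dense_of_ae h
  obtain ⟨s, hs, hs2⟩ := hd.exists_between hab
  exact ⟨s, hs2.1, hs2.2, hs⟩

theorem exists_lt_all {α : Type*} (Z : Finset α) (g : α → ℝ) (c : ℝ) (hg : ∀ z ∈ Z, c < g z) :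
    ∃ b, c < b ∧ ∀ z ∈ Z, b < g z := by
  rcases Z.eq_empty_or_nonempty with rfl | hne
  · exact ⟨c + 1, by linarith, by simp⟩
  · obtain ⟨z0, hz0, hmin⟩ := Z.exists_min_image g hne
    refine ⟨(c + g z0) / 2, by linarith [hg z0 hz0], fun z hz => ?_⟩
    have := hmin z hz
    linarith [hg z0 hz0]

theorem exists_lt_all' {α : Type*} (Z : Finset α) (g : α → ℝ) :
    ∃ b, ∀ z ∈ Z, b < g z := by
  rcases Z.eq_empty_or_nonempty with rfl | hne
  · exact ⟨0, by simp⟩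
  · obtain ⟨z0, hz0, hmin⟩ := Z.exists_min_image g hne
    exact ⟨g z0 - 1, fun z hz => by linarith [hmin z hz]⟩

theorem step (k : ℕ) (r : Fin (k+1)) (D : Set (Fin (k+1) → ℝ)) (hD : IsOpen D)
    (F : (Fin (k+1) → ℝ) → (Fin (k+1) → ℝ)) (hF : ∀ x ∈ D, ContDiffAt ℝ 1 F x)
    (Q : (Fin (k+1) → ℝ) → ℝ) (hQ : ∀ x ∈ D, ContDiffAt ℝ 1 Q x)
    (hQJ : ∀ x ∈ D, Q x ≠ 0 ↔ Function.Injective (fderiv ℝ F x))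
    (T : ℕ) (w : Fin T → (Fin (k+1) → ℝ) → ℝ) (hw : ∀ t, ∀ x ∈ D, ContDiffAt ℝ 1 (w t) x)
    (hproper : ∀ (a : Fin k → ℝ) (θ : Fin T → ℝ),
      IsCompact {x | x ∈ D ∧ (∀ l, F x (r.succAbove l) = a l) ∧ ∀ t, θ t ≤ w t x})
    (NQ NW : ℝ)
    (hNQ : ∀ (s : ℝ) (a : Fin k → ℝ) (Y : Finset (Fin (k+1) → ℝ)),
      (∀ x ∈ Y, x ∈ D ∧ upd F r Q x = r.insertNth s a ∧ Function.Injective (fderiv ℝ (upd F r Q) x)) →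
      (Y.card : ℝ) ≤ NQ)
    (hNW : ∀ (t : Fin T) (s : ℝ) (a : Fin k → ℝ) (Y : Finset (Fin (k+1) → ℝ)),
      (∀ x ∈ Y, x ∈ D ∧ upd F r (w t) x = r.insertNth s a ∧ Function.Injective (fderiv ℝ (upd F r (w t)) x)) →
      (Y.card : ℝ) ≤ NW)
    (Z : Finset (Fin (k+1) → ℝ))
    (hZ : ∀ z ∈ Z, z ∈ D ∧ F z = 0 ∧ Function.Injective (fderiv ℝ F z)) :
    (Z.card : ℝ) ≤ NQ + T / 2 * NW := by
  classical
  -- choice of `a`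
  have hA1 := sard r D (upd F r Q) (fun x hx => upd_contDiffAt F r Q x (hF x hx) (hQ x hx))
  have hA2 : ∀ᵐ a : Fin k → ℝ, ∀ t : Fin T, ∀ᵐ s : ℝ, ∀ x ∈ D, upd F r (w t) x = r.insertNth s a →
      Function.Injective (fderiv ℝ (upd F r (w t)) x) :=
    ae_all_iff.mpr fun t => sard r D (upd F r (w t)) (fun x hx => upd_contDiffAt F r (w t) x (hF x hx) (hw t x hx))
  have hp := persist D hD F hF Z 0 hZ
  have hc : Tendsto (fun a : Fin k → ℝ => (r.insertNth (0:ℝ) a : Fin (k+1) → ℝ)) (𝓝 0) (𝓝 0) := by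
    have h1 : Continuous (fun a : Fin k → ℝ => (r.insertNth (0:ℝ) a : Fin (k+1) → ℝ)) := by
      refine continuous_pi fun l => ?_
      rcases Fin.eq_self_or_eq_succAbove r l with rfl | ⟨j, rfl⟩
      · simpa using continuous_const
      · simpa using continuous_apply j
    have h2 : (r.insertNth (0:ℝ) (0 : Fin k → ℝ) : Fin (k+1) → ℝ) = 0 := by
      symm; rw [eq_insertNth_iff]; simp
    have := h1.tendsto 0
    rwa [h2] at this
  have hp2 := hc.eventually hp
  have hdense : Dense {a : Fin k → ℝ | (∀ᵐ s : ℝ, ∀ x ∈ D, upd F r Q x = r.insertNth s a →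
      Function.Injective (fderiv ℝ (upd F r Q) x)) ∧ ∀ t : Fin T, ∀ᵐ s : ℝ, ∀ x ∈ D, upd F r (w t) x = r.insertNth s a →
      Function.Injective (fderiv ℝ (upd F r (w t)) x)} := Measure.dense_of_ae (hA1.and hA2)
  obtain ⟨a, ⟨haQ, haW⟩, Z', hcard, hZ'⟩ := hdense.inter_nhds_nonempty hp2
  -- choice of `b`
  have hQne : ∀ z ∈ Z', 0 < |Q z| := fun z hz =>
    abs_pos.mpr ((hQJ z (hZ' z hz).1).mpr (hZ' z hz).2.2)
  obtain ⟨β, hβ, hβZ⟩ := exists_lt_all Z' (fun z => |Q z|) 0 hQne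
  have haQ2 : ∀ᵐ s : ℝ, ∀ x ∈ D, upd F r Q x = r.insertNth (-s) a →
      Function.Injective (fderiv ℝ (upd F r Q) x) :=
    (Measure.measurePreserving_neg (volume : Measure ℝ)).quasiMeasurePreserving.ae haQ
  obtain ⟨b, hb0, hbβ, hb1, hb2⟩ := exists_gen (haQ.and haQ2) 0 β hβ
  -- choice of `θ`
  have hθ : ∀ t, ∃ θ : ℝ, (∀ z ∈ Z', θ < w t z) ∧ ∀ x ∈ D, upd F r (w t) x = r.insertNth θ a →
      Function.Injective (fderiv ℝ (upd F r (w t)) x) := by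
    intro t
    obtain ⟨c, hc⟩ := exists_lt_all' Z' (w t)
    obtain ⟨s, h1, h2, h3⟩ := exists_gen (haW t) (c - 1) c (by linarith)
    exact ⟨s, fun z hz => h2.trans (hc z hz), h3⟩
  choose θ hθZ hθreg using hθ
  -- boundary sets
  have hfinQ : ∀ s : ℝ, (∀ x ∈ D, upd F r Q x = r.insertNth s a →
      Function.Injective (fderiv ℝ (upd F r Q) x)) → ∃ Y : Finset (Fin (k+1) → ℝ),
      (Y.card : ℝ) ≤ NQ ∧ ∀ x, x ∈ Y ↔ x ∈ D ∧ Q x = s ∧ ∀ l, F x (r.succAbove l) = a l := by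
    intro s hs
    have hb : ∀ Y : Finset (Fin (k+1) → ℝ), (∀ x ∈ Y, x ∈ {x | x ∈ D ∧ Q x = s ∧ ∀ l, F x (r.succAbove l) = a l}) →
        (Y.card : ℝ) ≤ NQ := by
      intro Y hY
      apply hNQ s a Y
      intro x hx
      have := (upd_eq_iff F r Q x s a).mpr (hY x hx).2
      exact ⟨(hY x hx).1, this, hs x (hY x hx).1 this⟩
    have hfin := finite_of_bdd _ NQ hb
    exact ⟨hfin.toFinset, hb _ (fun x hx => by simpa using hx), fun x => by rw [Set.Finite.mem_toFinset]; rfl⟩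
  have hfinW : ∀ t, ∃ Y : Finset (Fin (k+1) → ℝ),
      (Y.card : ℝ) ≤ NW ∧ ∀ x, x ∈ Y ↔ x ∈ D ∧ w t x = θ t ∧ ∀ l, F x (r.succAbove l) = a l := by
    intro t
    have hb : ∀ Y : Finset (Fin (k+1) → ℝ), (∀ x ∈ Y, x ∈ {x | x ∈ D ∧ w t x = θ t ∧ ∀ l, F x (r.succAbove l) = a l}) →
        (Y.card : ℝ) ≤ NW := by
      intro Y hY
      apply hNW t (θ t) a Y
      intro x hx
      have := (upd_eq_iff F r (w t) x (θ t) a).mpr (hY x hx).2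
      exact ⟨(hY x hx).1, this, hθreg t x (hY x hx).1 this⟩
    have hfin := finite_of_bdd _ NW hb
    exact ⟨hfin.toFinset, hb _ (fun x hx => by simpa using hx), fun x => by rw [Set.Finite.mem_toFinset]; rfl⟩
  choose YW hYWc hYW using hfinW
  -- the one-sided claim
  have main : ∀ σ : ℝ, (σ = 1 ∨ σ = -1) → ∀ YQ : Finset (Fin (k+1) → ℝ),
      (∀ x, x ∈ YQ ↔ x ∈ D ∧ Q x = σ * b ∧ ∀ l, F x (r.succAbove l) = a l) →
      2 * (Z'.filter fun z => 0 < σ * Q z).card ≤ YQ.card +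
        ∑ t, ((YW t).filter fun x => 0 < σ * Q x).card := by
    intro σ hσ YQ hYQ
    have hσ2 : σ * σ = 1 := by rcases hσ with rfl | rfl <;> norm_num
    have hσa : |σ| = 1 := by rcases hσ with rfl | rfl <;> norm_num
    set K := {x | x ∈ D ∧ (∀ l, F x (r.succAbove l) = a l) ∧ ∀ t, θ t ≤ w t x} with hK
    have hKc : IsCompact K := hproper a θ
    have hKD : ∀ x ∈ K, x ∈ D := fun x hx => hx.1
    have hQK : ContinuousOn (fun x => σ * Q x) K := fun x hx =>
      ((hQ x hx.1).continuousAt.const_mul σ |>.continuousWithinAt)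
    set X := K ∩ (fun x => σ * Q x) ⁻¹' Ici b with hX
    have hXc : IsCompact X :=
      hKc.of_isClosed_subset (hQK.preimage_isClosed_of_isClosed hKc.isClosed isClosed_Ici) inter_subset_left
    have hXinj : ∀ x ∈ X, Function.Injective (fderiv ℝ F x) := by
      intro x hx
      apply (hQJ x (hKD x hx.1)).mp
      intro h0
      have := hx.2
      simp only [mem_preimage, h0, mul_zero, mem_Ici] at this
      linarith
    set Bd := YQ ∪ Finset.univ.biUnion (fun t => (YW t).filter fun x => 0 < σ * Q x) with hBd
    have hsw := sweep X hXc (fun x => F x r)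
      (fun x hx => ((continuous_apply r).continuousAt.comp (hF x (hKD x hx.1)).continuousAt).continuousWithinAt)
      Bd ?_ ?_ (Z'.filter fun z => 0 < σ * Q z) ?_
    · refine hsw.trans ((Finset.card_union_le _ _).trans ?_)
      exact Nat.add_le_add_left Finset.card_biUnion_le _
    · -- local injectivity
      intro x hx
      obtain ⟨U, hU, hUi⟩ := (local_inj (hF x (hKD x hx.1)) (hXinj x hx)).1
      refine ⟨U, hU, fun y hy y' hy' hyy => hUi hy.2 hy'.2 ?_⟩
      funext l
      rcases Fin.eq_self_or_eq_succAbove r l with rfl | ⟨j, rfl⟩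
      · exact hyy
      · rw [hy.1.1.2.1 j, hy'.1.1.2.1 j]
    · -- openness
      intro x hx hxB U hU
      have hxD := hKD x hx.1
      have h1 : b < σ * Q x := by
        refine lt_of_le_of_ne hx.2 fun h => hxB ?_
        rw [hBd, Finset.mem_union]; left
        rw [hYQ]
        refine ⟨hxD, ?_, hx.1.2.1⟩
        rw [h, ← mul_assoc, hσ2, one_mul]
      have h2 : ∀ t, θ t < w t x := by
        intro t
        refine lt_of_le_of_ne (hx.1.2.2 t) fun h => hxB ?_
        rw [hBd, Finset.mem_union]; right
        rw [Finset.mem_biUnion]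
        refine ⟨t, Finset.mem_univ _, ?_⟩
        rw [Finset.mem_filter, hYW]
        exact ⟨⟨hxD, h.symm, hx.1.2.1⟩, hb0.trans h1⟩
      have hnb : {y | y ∈ U ∧ y ∈ D ∧ b < σ * Q y ∧ ∀ t, θ t < w t y} ∈ 𝓝 x := by
        refine Filter.inter_mem hU (Filter.inter_mem (hD.mem_nhds hxD) (Filter.inter_mem ?_ ?_))
        · exact ((hQ x hxD).continuousAt.const_mul σ).eventually (lt_mem_nhds h1)
        · exact Filter.eventually_all.mpr fun t => (hw t x hxD).continuousAt.eventually (lt_mem_nhds (h2 t))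
      have h3 := image_mem_map (m := F) hnb
      rw [(local_inj (hF x hxD) (hXinj x hx)).2] at h3
      have hcs : Tendsto (fun s : ℝ => (r.insertNth s a : Fin (k+1) → ℝ)) (𝓝 (F x r)) (𝓝 (F x)) := by
        have h4 : Continuous (fun s : ℝ => (r.insertNth s a : Fin (k+1) → ℝ)) := by
          refine continuous_pi fun l => ?_
          rcases Fin.eq_self_or_eq_succAbove r l with rfl | ⟨j, rfl⟩
          · simpa using continuous_id'
          · simpa using continuous_const
        have h5 : F x = r.insertNth (F x r) a := by
          rw [eq_insertNth_iff]; exact ⟨rfl, hx.1.2.1⟩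
        have := h4.tendsto (F x r)
        rwa [← h5] at this
      filter_upwards [hcs h3] with s hs
      obtain ⟨y, ⟨hyU, hyD, hyQ, hyw⟩, hys⟩ := hs
      have := (eq_insertNth_iff r (F y) s a).mp hys
      exact ⟨y, ⟨⟨⟨hyD, this.2, fun t => (hyw t).le⟩, hyQ.le⟩, hyU⟩, this.1⟩
    · intro z hz
      rw [Finset.mem_filter] at hz
      obtain ⟨hzD, hzF, hzi⟩ := hZ' z hz.1
      rw [eq_insertNth_iff] at hzF
      have hbz : b < σ * Q z := by
        have h1 : |σ * Q z| = |Q z| := by rw [abs_mul, hσa, one_mul]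
        rw [abs_of_pos hz.2] at h1
        rw [h1]; exact hbβ.trans (hβZ z hz.1)
      refine ⟨⟨⟨hzD, hzF.2, fun t => (hθZ t z hz.1).le⟩, hbz.le⟩, ?_, hzF.1⟩
      rw [hBd, Finset.mem_union, Finset.mem_biUnion]
      rintro (h | ⟨t, -, h⟩)
      · rw [hYQ] at h
        rw [h.2.1, ← mul_assoc, hσ2, one_mul] at hbz
        exact lt_irrefl _ hbz
      · rw [Finset.mem_filter, hYW] at h
        have := hθZ t z hz.1
        rw [h.1.2.1] at this
        exact lt_irrefl _ this
  obtain ⟨Y1, hY1c, hY1⟩ := hfinQ b hb1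
  obtain ⟨Y2, hY2c, hY2⟩ := hfinQ (-b) hb2
  have m1 := main 1 (Or.inl rfl) Y1 (by simpa using hY1)
  have m2 := main (-1) (Or.inr rfl) Y2 (by simpa using hY2)
  have hsplit : Z'.card = (Z'.filter fun z => 0 < (1:ℝ) * Q z).card + (Z'.filter fun z => 0 < (-1:ℝ) * Q z).card := by
    rw [← Finset.card_union_of_disjoint]
    · congr 1
      ext z
      simp only [Finset.mem_union, Finset.mem_filter]
      constructor
      · intro hz
        rcases lt_or_gt_of_ne (abs_pos.mp (hQne z hz)) with h | h
        · right; exact ⟨hz, by linarith⟩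
        · left; exact ⟨hz, by linarith⟩
      · rintro (h | h) <;> exact h.1
    · rw [Finset.disjoint_filter]
      intro x _ h1 h2
      linarith
  have hW : ∀ t, ((YW t).filter fun x => 0 < (1:ℝ) * Q x).card + ((YW t).filter fun x => 0 < (-1:ℝ) * Q x).card ≤ (YW t).card := by
    intro t
    rw [← Finset.card_union_of_disjoint]
    · exact Finset.card_le_card (Finset.union_subset (Finset.filter_subset _ _) (Finset.filter_subset _ _))
    · rw [Finset.disjoint_filter]
      intro x _ h1 h2
      linarith
  have hsum : (∑ t, ((YW t).filter fun x => 0 < (1:ℝ) * Q x).card) + (∑ t, ((YW t).filter fun x => 0 < (-1:ℝ) * Q x).card) ≤ ∑ t, (YW t).card := by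
    rw [← Finset.sum_add_distrib]
    exact Finset.sum_le_sum fun t _ => hW t
  have hsum2 : ((∑ t, (YW t).card : ℕ) : ℝ) ≤ T * NW := by
    push_cast
    calc ∑ t, ((YW t).card : ℝ) ≤ ∑ t : Fin T, NW := Finset.sum_le_sum fun t _ => hYWc t
      _ = T * NW := by simp
  have hfinal : 2 * Z.card ≤ Y1.card + Y2.card + ∑ t, (YW t).card := by omega
  have hf2 : (2 * Z.card : ℝ) ≤ Y1.card + Y2.card + ((∑ t, (YW t).card : ℕ) : ℝ) := by exact_mod_cast hfinal
  linarith

end Gale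


namespace Gale
open Set Filter Topology MeasureTheory

/-- `g` is a polynomial function of degree at most `d`. -/
def PolyDeg {κ : ℕ} (d : ℕ) (g : (Fin κ → ℝ) → ℝ) : Prop :=
  ∃ P : MvPolynomial (Fin κ) ℝ, P.totalDegree ≤ d ∧ ∀ x, g x = MvPolynomial.eval x P

theorem PolyDeg.mono {κ d d' : ℕ} {g : (Fin κ → ℝ) → ℝ} (h : PolyDeg d g) (hd : d ≤ d') : PolyDeg d' g := by
  obtain ⟨P, h1, h2⟩ := h
  exact ⟨P, h1.trans hd, h2⟩

theorem PolyDeg.congr {κ d : ℕ} {g g' : (Fin κ → ℝ) → ℝ} (h : PolyDeg d g) (hg : ∀ x, g' x = g x) : PolyDeg d g' := by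
  obtain ⟨P, h1, h2⟩ := h
  exact ⟨P, h1, fun x => (hg x).trans (h2 x)⟩

theorem polyDeg_const {κ d : ℕ} (c : ℝ) : PolyDeg d (fun _ : Fin κ → ℝ => c) :=
  ⟨MvPolynomial.C c, by simp, by simp⟩

theorem polyDeg_coord {κ : ℕ} (i : Fin κ) : PolyDeg 1 (fun x : Fin κ → ℝ => x i) :=
  ⟨MvPolynomial.X i, by simp, by simp⟩

theorem PolyDeg.add {κ d : ℕ} {g g' : (Fin κ → ℝ) → ℝ} (h : PolyDeg d g) (h' : PolyDeg d g') :
    PolyDeg d (fun x => g x + g' x) := by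
  obtain ⟨P, h1, h2⟩ := h
  obtain ⟨P', h1', h2'⟩ := h'
  exact ⟨P + P', (MvPolynomial.totalDegree_add _ _).trans (max_le h1 h1'), fun x => by simp [h2, h2']⟩

theorem PolyDeg.mul {κ d d' : ℕ} {g g' : (Fin κ → ℝ) → ℝ} (h : PolyDeg d g) (h' : PolyDeg d' g') :
    PolyDeg (d + d') (fun x => g x * g' x) := by
  obtain ⟨P, h1, h2⟩ := h
  obtain ⟨P', h1', h2'⟩ := h'
  exact ⟨P * P', (MvPolynomial.totalDegree_mul _ _).trans (add_le_add h1 h1'), fun x => by simp [h2, h2']⟩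

theorem PolyDeg.const_mul {κ d : ℕ} {g : (Fin κ → ℝ) → ℝ} (h : PolyDeg d g) (c : ℝ) :
    PolyDeg d (fun x => c * g x) := by
  have := (polyDeg_const (κ := κ) (d := 0) c).mul h
  rwa [zero_add] at this

theorem polyDeg_sum {κ d : ℕ} {ι : Type*} (s : Finset ι) (g : ι → (Fin κ → ℝ) → ℝ)
    (h : ∀ i ∈ s, PolyDeg d (g i)) : PolyDeg d (fun x => ∑ i ∈ s, g i x) := by
  classical
  induction s using Finset.induction_on with
  | empty => simpa using polyDeg_const 0
  | insert a s ha ih =>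
    refine ((h a (Finset.mem_insert_self _ _)).add (ih fun i hi => h i (Finset.mem_insert_of_mem hi))).congr ?_
    intro x; rw [Finset.sum_insert ha]

theorem polyDeg_prod {κ : ℕ} {ι : Type*} (s : Finset ι) (d : ι → ℕ) (g : ι → (Fin κ → ℝ) → ℝ)
    (h : ∀ i ∈ s, PolyDeg (d i) (g i)) : PolyDeg (∑ i ∈ s, d i) (fun x => ∏ i ∈ s, g i x) := by
  classical
  induction s using Finset.induction_on with
  | empty => simpa using polyDeg_const 1
  | insert a s ha ih =>
    rw [Finset.sum_insert ha]
    refine ((h a (Finset.mem_insert_self _ _)).mul (ih fun i hi => h i (Finset.mem_insert_of_mem hi))).congr ?_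
    intro x; rw [Finset.prod_insert ha]

theorem PolyDeg.pow {κ d : ℕ} {g : (Fin κ → ℝ) → ℝ} (h : PolyDeg d g) (n : ℕ) :
    PolyDeg (n * d) (fun x => g x ^ n) := by
  have := polyDeg_prod (Finset.range n) (fun _ => d) (fun _ => g) (fun _ _ => h)
  simpa using this

/-- precomposition with an affine map -/
theorem PolyDeg.comp {κ κ' d : ℕ} {g : (Fin κ → ℝ) → ℝ} (h : PolyDeg d g)
    (A : (Fin κ' → ℝ) → (Fin κ → ℝ)) (hA : ∀ c, PolyDeg 1 (fun x => A x c)) :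
    PolyDeg d (fun x => g (A x)) := by
  obtain ⟨P, h1, h2⟩ := h
  have h3 : PolyDeg d (fun x => ∑ m ∈ P.support, P.coeff m * ∏ i, (A x i) ^ m i) := by
    apply polyDeg_sum
    intro m hm
    apply PolyDeg.const_mul
    refine (polyDeg_prod Finset.univ (fun i => m i * 1) (fun i x => (A x i) ^ m i) 
      (fun i _ => (hA i).pow (m i))).mono ?_
    have := MvPolynomial.le_totalDegree hm
    rw [Finsupp.sum_fintype _ _ (by simp)] at this
    simpa using this.trans h1
  refine h3.congr fun x => ?_
  rw [h2, MvPolynomial.eval_eq']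

theorem polyDeg_contDiff {κ d : ℕ} {g : (Fin κ → ℝ) → ℝ} (h : PolyDeg d g) {n : WithTop ℕ∞} : ContDiff ℝ n g := by
  obtain ⟨P, h1, h2⟩ := h
  have : g = fun x => ∑ m ∈ P.support, P.coeff m * ∏ i, (x i) ^ m i := by
    funext x; rw [h2, MvPolynomial.eval_eq']
  rw [this]
  fun_prop

theorem hasFDerivAt_eval {κ : ℕ} (P : MvPolynomial (Fin κ) ℝ) (x v : Fin κ → ℝ) :
    fderiv ℝ (fun y => MvPolynomial.eval y P) x v = ∑ c, v c * MvPolynomial.eval x (MvPolynomial.pderiv c P) := by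
  have hd : ∀ Q : MvPolynomial (Fin κ) ℝ, DifferentiableAt ℝ (fun y => MvPolynomial.eval y Q) x := fun Q =>
    ((polyDeg_contDiff (d := Q.totalDegree) (n := 1) ⟨Q, le_rfl, fun _ => rfl⟩).differentiable one_ne_zero) x
  induction P using MvPolynomial.induction_on with
  | C a => simp
  | add p q hp hq =>
    simp only [map_add]
    rw [fderiv_fun_add (hd p) (hd q)]
    simp [hp, hq, mul_add, Finset.sum_add_distrib]
  | mul_X p i hp =>
    have h1 : (fun y : Fin κ → ℝ => MvPolynomial.eval y (p * MvPolynomial.X i)) = fun y => MvPolynomial.eval y p * y i := by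
      funext y; simp
    have h2 : HasFDerivAt (fun y : Fin κ → ℝ => y i) (ContinuousLinearMap.proj (R := ℝ) (φ := fun _ : Fin κ => ℝ) i) x := by
      exact (ContinuousLinearMap.proj (R := ℝ) (φ := fun _ : Fin κ => ℝ) i).hasFDerivAt
    rw [h1, ((hd p).hasFDerivAt.fun_mul h2).fderiv]
    simp only [ContinuousLinearMap.add_apply, ContinuousLinearMap.smul_apply, ContinuousLinearMap.proj_apply, hp,
      smul_eq_mul, MvPolynomial.pderiv_mul, MvPolynomial.pderiv_X, map_add, map_mul, MvPolynomial.eval_X, mul_add,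
      Finset.sum_add_distrib, Finset.mul_sum]
    rw [add_comm]
    congr 1
    · apply Finset.sum_congr rfl; intros; ring
    · rw [Finset.sum_eq_single i]
      · simp; ring
      · intro b _ hb
        simp [Pi.single_apply, hb.symm]
      · simp

theorem totalDegree_pderiv_le {κ : ℕ} (P : MvPolynomial (Fin κ) ℝ) (c : Fin κ) :
    (MvPolynomial.pderiv c P).totalDegree ≤ P.totalDegree - 1 := by
  rw [MvPolynomial.totalDegree, Finset.sup_le_iff]
  intro m hm
  rw [MvPolynomial.mem_support_iff, MvPolynomial.coeff_pderiv] at hm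
  have h1 : m + Finsupp.single c 1 ∈ P.support := by
    rw [MvPolynomial.mem_support_iff]; intro h; rw [h] at hm; simp at hm
  have := MvPolynomial.le_totalDegree h1
  rw [Finsupp.sum_add_index (by simp) (by simp)] at this
  simp at this
  omega

theorem PolyDeg.fderiv {κ d : ℕ} {g : (Fin κ → ℝ) → ℝ} (h : PolyDeg d g) (v : Fin κ → ℝ) :
    PolyDeg (d - 1) (fun x => fderiv ℝ g x v) := by
  obtain ⟨P, h1, h2⟩ := h
  have h3 : g = fun y => MvPolynomial.eval y P := funext h2
  rw [h3]
  have h4 : PolyDeg (d - 1) (fun x => ∑ c, v c * MvPolynomial.eval x (MvPolynomial.pderiv c P)) := by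
    apply polyDeg_sum
    intro c _
    apply PolyDeg.const_mul
    exact ⟨_, (totalDegree_pderiv_le P c).trans (by omega), fun _ => rfl⟩
  exact h4.congr fun x => hasFDerivAt_eval P x v

theorem polyDeg_det {κ k : ℕ} (d : Fin k → ℕ) (M : (Fin κ → ℝ) → Matrix (Fin k) (Fin k) ℝ)
    (h : ∀ i j, PolyDeg (d i) (fun x => M x i j)) : PolyDeg (∑ i, d i) (fun x => (M x).det) := by
  have : PolyDeg (∑ i, d i) (fun x => ∑ σ : Equiv.Perm (Fin k), ((Equiv.Perm.sign σ : ℤ) : ℝ) * ∏ i, (M x) i (σ i)) := by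
    apply polyDeg_sum
    intro σ _
    apply PolyDeg.const_mul
    exact polyDeg_prod _ _ _ (fun i _ => h i (σ i))
  refine this.congr fun x => ?_
  rw [← Matrix.det_transpose, Matrix.det_apply']
  rfl

end Gale


namespace Gale
open Set Filter Topology MeasureTheory

/-- affine forms -/
def aff {κ N : ℕ} (u0 : Fin N → ℝ) (u : Fin N → Fin κ → ℝ) (i : Fin N) (y : Fin κ → ℝ) : ℝ :=
  u0 i + ∑ l, u i l * y l

/-- the polyhedron -/
def Dom {κ N : ℕ} (u0 : Fin N → ℝ) (u : Fin N → Fin κ → ℝ) : Set (Fin κ → ℝ) :=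
  {y | ∀ i, 0 < aff u0 u i y}

theorem polyDeg_aff {κ N : ℕ} (u0 : Fin N → ℝ) (u : Fin N → Fin κ → ℝ) (i : Fin N) : PolyDeg 1 (aff u0 u i) := by
  have := (polyDeg_const (κ := κ) (d := 1) (u0 i)).add
    (polyDeg_sum Finset.univ (fun l y => u i l * y l) (fun l _ => (polyDeg_coord l).const_mul (u i l)))
  exact this

theorem isOpen_Dom {κ N : ℕ} (u0 : Fin N → ℝ) (u : Fin N → Fin κ → ℝ) : IsOpen (Dom u0 u) := by
  have : Dom u0 u = ⋂ i, {y | 0 < aff u0 u i y} := by ext y; simp [Dom]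
  rw [this]
  exact isOpen_iInter_of_finite fun i =>
    isOpen_lt continuous_const (polyDeg_contDiff (polyDeg_aff u0 u i) (n := 0)).continuous

theorem fderiv_aff {κ N : ℕ} (u0 : Fin N → ℝ) (u : Fin N → Fin κ → ℝ) (i : Fin N) (x v : Fin κ → ℝ) :
    fderiv ℝ (aff u0 u i) x v = ∑ l, u i l * v l := by
  have h : HasFDerivAt (aff u0 u i) (∑ l, u i l • (ContinuousLinearMap.proj (R := ℝ) (φ := fun _ : Fin κ => ℝ) l)) x := by
    have h1 := (HasFDerivAt.fun_sum (u := Finset.univ) (fun l _ => 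
      ((ContinuousLinearMap.proj (R := ℝ) (φ := fun _ : Fin κ => ℝ) l).hasFDerivAt (x := x)).const_mul (u i l)))
    exact h1.const_add (u0 i)
  rw [h.fderiv]
  simp

/-- log row -/
noncomputable def lg {κ N : ℕ} (u0 : Fin N → ℝ) (u : Fin N → Fin κ → ℝ) (e : Fin N → ℝ) (y : Fin κ → ℝ) : ℝ :=
  ∑ i, e i * Real.log (aff u0 u i y)

theorem contDiffAt_log_aff {κ N : ℕ} (u0 : Fin N → ℝ) (u : Fin N → Fin κ → ℝ) (i : Fin N) (x : Fin κ → ℝ)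
    (hx : x ∈ Dom u0 u) {n : WithTop ℕ∞} : ContDiffAt ℝ n (fun y => Real.log (aff u0 u i y)) x :=
  (polyDeg_contDiff (polyDeg_aff u0 u i)).contDiffAt.log (hx i).ne'

theorem contDiffAt_lg {κ N : ℕ} (u0 : Fin N → ℝ) (u : Fin N → Fin κ → ℝ) (e : Fin N → ℝ) (x : Fin κ → ℝ)
    (hx : x ∈ Dom u0 u) {n : WithTop ℕ∞} : ContDiffAt ℝ n (lg u0 u e) x := by
  unfold lg
  exact ContDiffAt.sum fun i _ => contDiffAt_const.mul (contDiffAt_log_aff u0 u i x hx)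

theorem fderiv_lg {κ N : ℕ} (u0 : Fin N → ℝ) (u : Fin N → Fin κ → ℝ) (e : Fin N → ℝ) (x v : Fin κ → ℝ)
    (hx : x ∈ Dom u0 u) : fderiv ℝ (lg u0 u e) x v = ∑ i, e i / aff u0 u i x * ∑ l, u i l * v l := by
  have hd : ∀ i, DifferentiableAt ℝ (aff u0 u i) x := fun i =>
    ((polyDeg_contDiff (polyDeg_aff u0 u i) (n := 1)).differentiable one_ne_zero) x
  have h : HasFDerivAt (lg u0 u e) (∑ i, e i • ((aff u0 u i x)⁻¹ • fderiv ℝ (aff u0 u i) x)) x := by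
    exact HasFDerivAt.fun_sum (fun i _ => ((hd i).hasFDerivAt.log (hx i).ne').const_mul (e i))
  rw [h.fderiv]
  simp only [sum_apply, smul_apply, fderiv_aff, smul_eq_mul]
  refine Finset.sum_congr rfl fun i _ => ?_
  rw [div_eq_mul_inv, mul_assoc]

/-- the class of mixed systems -/
structure IsSys (n κ r : ℕ) (u0 : Fin (n + κ) → ℝ) (u : Fin (n + κ) → Fin κ → ℝ)
    (F : (Fin κ → ℝ) → (Fin κ → ℝ)) : Prop where
  inj : ∀ v : Fin κ → ℝ, (∀ i, ∑ l, u i l * v l = 0) → v = 0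
  poly : ∀ l : Fin κ, l.val < r → PolyDeg (n * 2 ^ l.val) (fun y => F y l)
  log : ∀ l : Fin κ, r ≤ l.val → ∃ (e : Fin (n + κ) → ℝ) (c : ℝ), ∀ y ∈ Dom u0 u, F y l = lg u0 u e y - c

theorem IsSys.contDiffAt {n κ r : ℕ} {u0 : Fin (n + κ) → ℝ} {u : Fin (n + κ) → Fin κ → ℝ}
    {F : (Fin κ → ℝ) → (Fin κ → ℝ)} (h : IsSys n κ r u0 u F) (x : Fin κ → ℝ) (hx : x ∈ Dom u0 u) {N : WithTop ℕ∞} :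
    ContDiffAt ℝ N F x := by
  rw [contDiffAt_pi]
  intro l
  rcases lt_or_ge l.val r with hl | hl
  · exact (polyDeg_contDiff (h.poly l hl)).contDiffAt
  · obtain ⟨e, c, hec⟩ := h.log l hl
    have : (fun y => F y l) =ᶠ[𝓝 x] fun y => lg u0 u e y - c := by
      filter_upwards [(isOpen_Dom u0 u).mem_nhds hx] with y hy using hec y hy
    exact ((contDiffAt_lg u0 u e x hx).sub contDiffAt_const).congr_of_eventuallyEq this

theorem fderiv_comp_apply {κ k : ℕ} {F : (Fin κ → ℝ) → (Fin k → ℝ)} {x : Fin κ → ℝ} (h : DifferentiableAt ℝ F x)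
    (v : Fin κ → ℝ) (l : Fin k) : fderiv ℝ F x v l = fderiv ℝ (fun y => F y l) x v := by
  have := (hasFDerivAt_pi'.mp h.hasFDerivAt l).fderiv
  rw [this]; rfl

theorem fderiv_log_row {κ N : ℕ} {u0 : Fin N → ℝ} {u : Fin N → Fin κ → ℝ} {g : (Fin κ → ℝ) → ℝ} {e : Fin N → ℝ} {c : ℝ}
    (h : ∀ y ∈ Dom u0 u, g y = lg u0 u e y - c) (x v : Fin κ → ℝ) (hx : x ∈ Dom u0 u) :
    fderiv ℝ g x v = ∑ i, e i / aff u0 u i x * ∑ l, u i l * v l := by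
  have : g =ᶠ[𝓝 x] fun y => lg u0 u e y - c := by
    filter_upwards [(isOpen_Dom u0 u).mem_nhds hx] with y hy using h y hy
  rw [this.fderiv_eq, fderiv_sub_const, fderiv_lg u0 u e x v hx]

open Classical in
theorem det_expand {k N : ℕ} (i0 : Fin N) (r : ℕ) (e : Fin k → Fin N → ℝ) (U : Fin N → Fin k → ℝ) (p : Fin N → ℝ)
    (hp : ∀ i, p i ≠ 0) (G : Fin k → Fin k → ℝ) :
    (∏ i, p i) * (Matrix.of fun l c : Fin k => if l.val < r then G l c else ∑ i, e l i / p i * U i c).det =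
    ∑ σ ∈ Fintype.piFinset (fun l : Fin k => if l.val < r then {i0} else (Finset.univ : Finset (Fin N))),
      if Set.InjOn σ {l | r ≤ l.val} then
        (∏ l ∈ Finset.univ.filter (fun l : Fin k => r ≤ l.val), e l (σ l)) *
        ((∏ i ∈ ((Finset.univ.filter (fun l : Fin k => r ≤ l.val)).image σ)ᶜ, p i) *
        (Matrix.of fun l c : Fin k => if l.val < r then G l c else U (σ l) c).det) else 0 := by
  classical
  set A := (fun l : Fin k => if l.val < r then {i0} else (Finset.univ : Finset (Fin N))) with hA
  set w : Fin k → Fin N → ℝ := fun l i => if l.val < r then 1 else e l i / p i with hw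
  set V : Fin k → Fin N → (Fin k → ℝ) := fun l i => if l.val < r then G l else U i with hV
  have h1 : (Matrix.of fun l c : Fin k => if l.val < r then G l c else ∑ i, e l i / p i * U i c) =
      (fun l => ∑ i ∈ A l, w l i • V l i : Matrix (Fin k) (Fin k) ℝ) := by
    funext l c
    by_cases hl : l.val < r
    · simp [hA, hw, hV, hl]
    · simp [hA, hw, hV, hl]
  have h2 : (Matrix.of fun l c : Fin k => if l.val < r then G l c else ∑ i, e l i / p i * U i c).det =
      ∑ σ ∈ Fintype.piFinset A, (∏ l, w l (σ l)) * Matrix.det (fun l => V l (σ l) : Matrix (Fin k) (Fin k) ℝ) := by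
    rw [h1]
    have := MultilinearMap.map_sum_finset (Matrix.detRowAlternating (R := ℝ) (n := Fin k)).toMultilinearMap
      (fun l i => w l i • V l i) A
    refine this.trans (Finset.sum_congr rfl fun σ _ => ?_)
    exact MultilinearMap.map_smul_univ _ _ _
  rw [h2, Finset.mul_sum]
  refine Finset.sum_congr rfl fun σ _ => ?_
  have h3 : (fun l => V l (σ l) : Matrix (Fin k) (Fin k) ℝ) =
      Matrix.of fun l c : Fin k => if l.val < r then G l c else U (σ l) c := by
    funext l c
    by_cases hl : l.val < r <;> simp [hV, hl]
  rw [h3]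
  split_ifs with hinj
  · rw [← mul_assoc, ← mul_assoc]
    congr 1
    have h4 : ∏ l, w l (σ l) = ∏ l ∈ Finset.univ.filter (fun l : Fin k => r ≤ l.val), e l (σ l) / p (σ l) := by
      rw [Finset.prod_filter]
      refine Finset.prod_congr rfl fun l _ => ?_
      by_cases hl : l.val < r
      · simp [hw, hl]
      · simp [hw, hl, not_lt.mp hl]
    have h5 : ∏ i ∈ (Finset.univ.filter (fun l : Fin k => r ≤ l.val)).image σ, p i =
        ∏ l ∈ Finset.univ.filter (fun l : Fin k => r ≤ l.val), p (σ l) := by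
      apply Finset.prod_image
      intro a ha b hb hab
      exact hinj (by simpa using ha) (by simpa using hb) hab
    rw [h4, ← Finset.prod_mul_prod_compl ((Finset.univ.filter (fun l : Fin k => r ≤ l.val)).image σ) p, h5,
      Finset.prod_div_distrib]
    have h6 : ∏ l ∈ Finset.univ.filter (fun l : Fin k => r ≤ l.val), p (σ l) ≠ 0 :=
      Finset.prod_ne_zero_iff.mpr fun l _ => hp _
    field_simp
  · have : ∃ a b : Fin k, r ≤ a.val ∧ r ≤ b.val ∧ a ≠ b ∧ σ a = σ b := by
      simp only [Set.InjOn, Set.mem_setOf_eq, not_forall] at hinj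
      obtain ⟨a, ha, b, hb, hab, hne⟩ := hinj
      exact ⟨a, b, ha, hb, hne, hab⟩
    obtain ⟨a, b, ha, hb, hne, hab⟩ := this
    rw [Matrix.det_zero_of_row_eq hne, mul_zero, mul_zero]
    funext c
    simp [not_lt.mpr ha, not_lt.mpr hb, hab]

theorem injective_iff_det {k : ℕ} (A : (Fin k → ℝ) →L[ℝ] (Fin k → ℝ)) :
    Function.Injective A ↔ (Matrix.of fun l c : Fin k => A (Pi.single c 1) l).det ≠ 0 := by
  have h1 : (Matrix.of fun l c : Fin k => A (Pi.single c 1) l) = LinearMap.toMatrix' (A : (Fin k → ℝ) →ₗ[ℝ] (Fin k → ℝ)) := by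
    ext l c
    simp [LinearMap.toMatrix'_apply]
  rw [h1, LinearMap.det_toMatrix', ← isUnit_iff_ne_zero, ← LinearMap.isUnit_iff_isUnit_det,
    LinearMap.isUnit_iff_ker_eq_bot, LinearMap.ker_eq_bot]
  rfl

theorem deg_sum (n κ r : ℕ) (hn : 1 ≤ n) (hr : r ≤ κ) :
    (∑ l : Fin κ, if l.val < r then n * 2 ^ l.val - 1 else 0) + r + n = n * 2 ^ r := by
  have h1 : (∑ l : Fin κ, if l.val < r then n * 2 ^ l.val - 1 else 0) = ∑ l ∈ Finset.range r, (n * 2 ^ l - 1) := by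
    rw [Fin.sum_univ_eq_sum_range (fun l => if l < r then n * 2 ^ l - 1 else 0) κ, ← Finset.sum_filter]
    congr 1
    ext l; simp; omega
  rw [h1]
  clear h1 hr
  induction r with
  | zero => simp
  | succ r ih =>
    rw [Finset.sum_range_succ, pow_succ, ← mul_assoc]
    have : 1 ≤ n * 2 ^ r := Nat.mul_pos hn (by positivity)
    omega

theorem exists_Q {n κ r : ℕ} (hn : 1 ≤ n) (hr : r ≤ κ) {u0 : Fin (n + κ) → ℝ} {u : Fin (n + κ) → Fin κ → ℝ}
    {F : (Fin κ → ℝ) → (Fin κ → ℝ)} (h : IsSys n κ r u0 u F) :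
    ∃ Q : (Fin κ → ℝ) → ℝ, PolyDeg (n * 2 ^ r) Q ∧
      ∀ x ∈ Dom u0 u, (Q x ≠ 0 ↔ Function.Injective (fderiv ℝ F x)) := by
  classical
  have hlog : ∀ l : Fin κ, ∃ (e : Fin (n + κ) → ℝ) (c : ℝ), r ≤ l.val → ∀ y ∈ Dom u0 u, F y l = lg u0 u e y - c := by
    intro l
    by_cases hl : r ≤ l.val
    · obtain ⟨e, c, hec⟩ := h.log l hl
      exact ⟨e, c, fun _ => hec⟩
    · exact ⟨0, 0, fun h => absurd h hl⟩
  choose e c hec using hlog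
  let i0 : Fin (n + κ) := ⟨0, by omega⟩
  let G : (Fin κ → ℝ) → Fin κ → Fin κ → ℝ := fun x l c => fderiv ℝ (fun y => F y l) x (Pi.single c 1)
  refine ⟨fun x => ∑ σ ∈ Fintype.piFinset (fun l : Fin κ => if l.val < r then {i0} else (Finset.univ : Finset (Fin (n + κ)))),
      if Set.InjOn σ {l | r ≤ l.val} then
        (∏ l ∈ Finset.univ.filter (fun l : Fin κ => r ≤ l.val), e l (σ l)) *
        ((∏ i ∈ ((Finset.univ.filter (fun l : Fin κ => r ≤ l.val)).image σ)ᶜ, aff u0 u i x) *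
        (Matrix.of fun l c : Fin κ => if l.val < r then G x l c else u (σ l) c).det) else 0, ?_, ?_⟩
  · apply polyDeg_sum
    intro σ _
    by_cases hinj : Set.InjOn σ {l | r ≤ l.val}
    · simp only [if_pos hinj]
      apply PolyDeg.const_mul
      refine ((polyDeg_prod _ (fun _ => 1) _ (fun i _ => polyDeg_aff u0 u i)).mul
        (polyDeg_det (fun l : Fin κ => if l.val < r then n * 2 ^ l.val - 1 else 0) _ ?_)).mono ?_
      · intro l c
        by_cases hl : l.val < r
        · simp only [Matrix.of_apply, if_pos hl]
          exact (h.poly l hl).fderiv _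
        · simp only [Matrix.of_apply, if_neg hl]
          exact polyDeg_const _
      · have h1 := deg_sum n κ r hn hr
        have h2 : ((Finset.univ.filter (fun l : Fin κ => r ≤ l.val)).image σ).card = κ - r := by
          rw [Finset.card_image_of_injOn]
          · have h3 := Finset.card_filter_add_card_filter_not (s := (Finset.univ : Finset (Fin κ))) (fun l : Fin κ => l.val < r)
            simp only [not_lt, Finset.card_univ, Fintype.card_fin] at h3
            have h4 : (Finset.univ.filter (fun l : Fin κ => l.val < r)).card = r := by
              rw [Fin.card_filter_val_lt]; omega
            omega
          · intro a ha b hb hab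
            exact hinj (by simpa using ha) (by simpa using hb) hab
        rw [Finset.sum_const, Finset.card_compl, h2, Fintype.card_fin, smul_eq_mul]
        omega
    · simp only [if_neg hinj]
      exact polyDeg_const 0
  · intro x hx
    beta_reduce
    rw [← det_expand i0 r e u (fun i => aff u0 u i x) (fun i => (hx i).ne') (G x), injective_iff_det, mul_ne_zero_iff]
    have hprod : (∏ i, aff u0 u i x) ≠ 0 := Finset.prod_ne_zero_iff.mpr fun i _ => (hx i).ne'
    have hM : (Matrix.of fun l c : Fin κ => (fderiv ℝ F x) (Pi.single c 1) l) =
        Matrix.of fun l c : Fin κ => if l.val < r then G x l c else ∑ i, e l i / aff u0 u i x * u i c := by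
      ext l c
      have hd : DifferentiableAt ℝ F x := (h.contDiffAt x hx (N := 1)).differentiableAt one_ne_zero
      simp only [Matrix.of_apply]
      rw [fderiv_comp_apply hd]
      split_ifs with hl
      · rfl
      · rw [fderiv_log_row (hec l (not_lt.mp hl)) x _ hx]
        refine Finset.sum_congr rfl fun i _ => ?_
        congr 1
        simp [Pi.single_apply]
    rw [hM]
    exact ⟨fun h => h.2, fun h => ⟨hprod, h⟩⟩

end Gale


namespace Gale
open Set Filter Topology MeasureTheory

theorem sum_insertNth {k : ℕ} (c : Fin (k+1)) (g : Fin (k+1) → ℝ) (s : ℝ) (z : Fin k → ℝ) :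
    ∑ l, g l * (c.insertNth s z : Fin (k+1) → ℝ) l = g c * s + ∑ l, g (c.succAbove l) * z l := by
  rw [Fin.sum_univ_succAbove _ c]
  simp

theorem sum_succAbove_add {n k : ℕ} (i : Fin (n + (k+1))) (f : Fin (n + (k+1)) → ℝ) :
    ∑ j, f j = f i + ∑ j : Fin (n + k), f (Fin.succAbove (n := n + k) i j) :=
  Fin.sum_univ_succAbove (n := n + k) f i

theorem fderiv_upd {k : ℕ} (F : (Fin (k+1) → ℝ) → (Fin (k+1) → ℝ)) (r : Fin (k+1)) (w : (Fin (k+1) → ℝ) → ℝ)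
    (x : Fin (k+1) → ℝ) (hF : ContDiffAt ℝ 1 F x) (hw : ContDiffAt ℝ 1 w x) (v : Fin (k+1) → ℝ) :
    fderiv ℝ (upd F r w) x v r = fderiv ℝ w x v ∧ 
    ∀ l, fderiv ℝ (upd F r w) x v (r.succAbove l) = fderiv ℝ F x v (r.succAbove l) := by
  have h1 := (upd_contDiffAt F r w x hF hw).differentiableAt one_ne_zero
  have h2 := hF.differentiableAt one_ne_zero
  refine ⟨?_, fun l => ?_⟩
  · rw [fderiv_comp_apply h1]; simp only [upd_same]
  · rw [fderiv_comp_apply h1, fderiv_comp_apply h2]; simp only [upd_succAbove]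

theorem wall_bound {n k : ℕ} (r : Fin (k+1)) {u0 : Fin (n + (k+1)) → ℝ} {u : Fin (n + (k+1)) → Fin (k+1) → ℝ}
    {F : (Fin (k+1) → ℝ) → (Fin (k+1) → ℝ)} (hS : IsSys n (k+1) r.val u0 u F)
    (NW : ℝ) (hNW0 : 0 ≤ NW)
    (hMain : ∀ (u0' : Fin (n + k) → ℝ) (u' : Fin (n + k) → Fin k → ℝ) (F' : (Fin k → ℝ) → (Fin k → ℝ)),
      IsSys n k r.val u0' u' F' → ∀ Z : Finset (Fin k → ℝ),
      (∀ z ∈ Z, z ∈ Dom u0' u' ∧ F' z = 0 ∧ Function.Injective (fderiv ℝ F' z)) → (Z.card : ℝ) ≤ NW)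
    (w : (Fin (k+1) → ℝ) → ℝ) (hw : ∀ x ∈ Dom u0 u, ContDiffAt ℝ 1 w x) (s : ℝ) (a : Fin k → ℝ)
    (i : Fin (n + (k+1))) (h0 : ℝ) (h : Fin (k+1) → ℝ) (γ : ℝ) (ρ : Fin (n + (k+1)) → ℝ) (hρ : ρ i = 0)
    (H1 : ∀ x ∈ Dom u0 u, w x = s → h0 + ∑ l, h l * x l = 0)
    (H2 : ∀ x ∈ Dom u0 u, w x = s → ∀ v : Fin (k+1) → ℝ, ∑ l, h l * v l = 0 → fderiv ℝ w x v = 0)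
    (H3 : ∀ x ∈ Dom u0 u, h0 + ∑ l, h l * x l = 0 →
      Real.log (aff u0 u i x) = γ + ∑ j, ρ j * Real.log (aff u0 u j x))
    (H4 : ∀ v : Fin (k+1) → ℝ, ∑ l, h l * v l = 0 → (∀ j, j ≠ i → ∑ l, u j l * v l = 0) → ∑ l, u i l * v l = 0)
    (H5 : ∀ x : Fin (k+1) → ℝ, h0 + ∑ l, h l * x l = 0 → (∀ j, j ≠ i → 0 < aff u0 u j x) → 0 < aff u0 u i x)
    (Y : Finset (Fin (k+1) → ℝ))
    (hY : ∀ x ∈ Y, x ∈ Dom u0 u ∧ upd F r w x = r.insertNth s a ∧ Function.Injective (fderiv ℝ (upd F r w) x)) :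
    (Y.card : ℝ) ≤ NW := by
  classical
  by_cases hh : ∀ c, h c = 0
  · rcases Y.eq_empty_or_nonempty with rfl | ⟨x, hx⟩
    · simpa using hNW0
    · exfalso
      obtain ⟨hxD, hxw, hxi⟩ := hY x hx
      obtain ⟨v, hv⟩ := (LinearMap.injective_iff_surjective 
        (f := (fderiv ℝ (upd F r w) x : (Fin (k+1) → ℝ) →ₗ[ℝ] (Fin (k+1) → ℝ)))).mp hxi (Pi.single r 1)
      have h1 := (fderiv_upd F r w x (hS.contDiffAt x hxD) (hw x hxD) v).1
      have h2 := H2 x hxD ((upd_eq_iff F r w x s a).mp hxw).1 v (by simp [hh])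
      have h3 := congrFun hv r
      rw [h2] at h1
      simp only [ContinuousLinearMap.coe_coe] at h3
      rw [h1] at h3
      simp at h3
  push Not at hh
  obtain ⟨c, hc⟩ := hh
  let A : (Fin k → ℝ) → (Fin (k+1) → ℝ) := fun z => c.insertNth (-(h0 + ∑ l, h (c.succAbove l) * z l) / h c) z
  let B : (Fin k → ℝ) → (Fin (k+1) → ℝ) := fun z => c.insertNth (-(∑ l, h (c.succAbove l) * z l) / h c) z
  have hA0 : ∀ z, h0 + ∑ l, h l * A z l = 0 := by
    intro z
    simp only [A]
    rw [sum_insertNth]; field_simp; ring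
  have hB0 : ∀ z, ∑ l, h l * B z l = 0 := by
    intro z
    simp only [B]
    rw [sum_insertNth]; field_simp; ring
  have hAr : ∀ x : Fin (k+1) → ℝ, h0 + ∑ l, h l * x l = 0 → A (fun l => x (c.succAbove l)) = x := by
    intro x hx
    symm
    simp only [A]
    rw [eq_insertNth_iff]
    refine ⟨?_, fun l => rfl⟩
    rw [Fin.sum_univ_succAbove _ c] at hx
    field_simp
    linarith
  let u0' : Fin (n + k) → ℝ := fun j => u0 (i.succAbove j) - u (i.succAbove j) c * h0 / h c
  let u' : Fin (n + k) → Fin k → ℝ := fun j l =>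
    u (i.succAbove j) (c.succAbove l) - u (i.succAbove j) c * h (c.succAbove l) / h c
  have hu' : ∀ j v, ∑ l, u' j l * v l = ∑ l, u (i.succAbove j) l * B v l := by
    intro j v
    simp only [B, u']
    rw [sum_insertNth]
    simp only [sub_mul, Finset.sum_sub_distrib]
    rw [neg_div, mul_neg, Finset.sum_div, Finset.mul_sum, neg_add_eq_sub]
    congr 1
    refine Finset.sum_congr rfl fun l _ => ?_
    ring
  have haff : ∀ j z, aff u0' u' j z = aff u0 u (i.succAbove j) (A z) := by
    intro j z
    unfold aff
    rw [hu']
    simp only [A, B, u0']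
    rw [sum_insertNth, sum_insertNth]
    ring
  have hDom : ∀ z, z ∈ Dom u0' u' ↔ A z ∈ Dom u0 u := by
    intro z
    constructor
    · intro hz
      have h1 : ∀ j, j ≠ i → 0 < aff u0 u j (A z) := by
        intro j hj
        obtain ⟨j', rfl⟩ := Fin.exists_succAbove_eq hj
        rw [← haff]; exact hz j'
      intro j
      by_cases hj : j = i
      · subst hj; exact H5 _ (hA0 z) h1
      · exact h1 j hj
    · intro hz j
      rw [haff]; exact hz _
  let F' : (Fin k → ℝ) → (Fin k → ℝ) := fun z l => F (A z) (r.succAbove l) - a l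
  have hApoly : ∀ c', PolyDeg 1 (fun z => A z c') := by
    intro c'
    rcases Fin.eq_self_or_eq_succAbove c c' with rfl | ⟨l, rfl⟩
    · simp only [A, Fin.insertNth_apply_same]
      have h1 := ((polyDeg_const (κ := k) (d := 1) h0).add (polyDeg_sum Finset.univ (fun l z => h (c'.succAbove l) * z l)
        (fun l _ => (polyDeg_coord l).const_mul (h (c'.succAbove l))))).const_mul (-1 / h c')
      refine h1.congr fun z => ?_
      ring
    · simp only [A, Fin.insertNth_apply_succAbove]
      exact polyDeg_coord l
  have hAder : ∀ z v, HasFDerivAt A (fderiv ℝ A z) z ∧ fderiv ℝ A z v = B v := by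
    intro z v
    have hd : DifferentiableAt ℝ A z :=
      differentiableAt_pi.mpr fun c' => ((polyDeg_contDiff (hApoly c') (n := 1)).differentiable one_ne_zero) z
    refine ⟨hd.hasFDerivAt, ?_⟩
    have hline : ∀ t : ℝ, A (z + t • v) = A z + t • B v := by
      intro t
      simp only [A, B]
      symm
      rw [eq_insertNth_iff]
      refine ⟨?_, fun l => by simp⟩
      simp only [Pi.add_apply, Pi.smul_apply, Fin.insertNth_apply_same, smul_eq_mul, mul_add, Finset.sum_add_distrib]
      have : ∑ l, h (c.succAbove l) * (t * v l) = t * ∑ l, h (c.succAbove l) * v l := by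
        rw [Finset.mul_sum]; refine Finset.sum_congr rfl fun l _ => by ring
      rw [this]; ring
    have h1 : HasLineDerivAt ℝ A (B v) z v := by
      unfold HasLineDerivAt
      simp only [hline]
      have := ((hasDerivAt_id (0:ℝ)).smul_const (B v)).const_add (A z)
      simpa using this
    exact (hd.hasFDerivAt.hasLineDerivAt v).unique h1
  have hS' : IsSys n k r.val u0' u' F' := by
    refine ⟨?_, ?_, ?_⟩
    · intro v hv
      have h1 : B v = 0 := by
        apply hS.inj
        have h2 : ∀ j, j ≠ i → ∑ l, u j l * B v l = 0 := by
          intro j hj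
          obtain ⟨j', rfl⟩ := Fin.exists_succAbove_eq hj
          rw [← hu']; exact hv j'
        intro j
        by_cases hj : j = i
        · subst hj; exact H4 _ (hB0 v) h2
        · exact h2 j hj
      funext l
      have := congrFun h1 (c.succAbove l)
      simpa [B] using this
    · intro l hl
      have hv : (r.succAbove l).val = l.val := by
        rw [Fin.succAbove_of_castSucc_lt _ _ (by simpa [Fin.lt_def] using hl)]; rfl
      have h1 := (hS.poly (r.succAbove l) (by rw [hv]; exact hl)).comp A hApoly
      rw [hv] at h1
      exact (h1.add (polyDeg_const (-a l))).congr fun z => by simp only [F']; ring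
    · intro l hl
      have hv : (r.succAbove l).val = l.val + 1 := by
        rw [Fin.succAbove_of_le_castSucc _ _ (by simpa [Fin.le_def] using hl)]; rfl
      obtain ⟨e, c1, hec⟩ := hS.log (r.succAbove l) (by omega)
      refine ⟨fun j => e (i.succAbove j) + e i * ρ (i.succAbove j), c1 - e i * γ + a l, fun z hz => ?_⟩
      have hz' := (hDom z).mp hz
      simp only [F']
      rw [hec _ hz']
      unfold lg
      have h3 := H3 _ hz' (hA0 z)
      rw [sum_succAbove_add i, hρ, zero_mul, zero_add] at h3
      rw [sum_succAbove_add i, h3]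
      simp only [haff, add_mul, Finset.sum_add_distrib]
      simp only [mul_assoc, ← Finset.mul_sum]
      ring
  have hYA : ∀ x ∈ Y, A (fun l => x (c.succAbove l)) = x := fun x hx =>
    hAr x (H1 x (hY x hx).1 ((upd_eq_iff F r w x s a).mp (hY x hx).2.1).1)
  have hcard : (Y.image fun x => (fun l => x (c.succAbove l) : Fin k → ℝ)).card = Y.card := by
    apply Finset.card_image_of_injOn
    intro x hx y hy hxy
    rw [← hYA x hx, ← hYA y hy]
    exact congrArg A hxy
  rw [← hcard]
  apply hMain u0' u' F' hS'
  intro z hz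
  obtain ⟨x, hx, rfl⟩ := Finset.mem_image.mp hz
  have hAx := hYA x hx
  obtain ⟨hxD, hxw, hxi⟩ := hY x hx
  obtain ⟨hw1, hF1⟩ := (upd_eq_iff F r w x s a).mp hxw
  set z := (fun l => x (c.succAbove l) : Fin k → ℝ) with hzdef
  refine ⟨(hDom _).mpr (by rw [hAx]; exact hxD), ?_, ?_⟩
  · funext l
    simp only [F', hAx, hF1, sub_self, Pi.zero_apply]
  · have hFd := ((hS.contDiffAt x hxD (N := 1)).differentiableAt one_ne_zero)
    have hFA : HasFDerivAt (fun z => F (A z)) ((fderiv ℝ F x).comp (fderiv ℝ A z)) z := by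
      have h1 : HasFDerivAt F (fderiv ℝ F x) (A z) := by rw [hAx]; exact hFd.hasFDerivAt
      exact h1.comp z (hAder z 0).1
    have hF'd : ∀ v l, fderiv ℝ F' z v l = fderiv ℝ F x (B v) (r.succAbove l) := by
      intro v l
      have h1 : DifferentiableAt ℝ F' z := by
        rw [differentiableAt_pi]
        intro l
        exact (differentiableAt_pi.mp hFA.differentiableAt (r.succAbove l)).sub_const _
      rw [fderiv_comp_apply h1]
      simp only [F']
      rw [fderiv_sub_const, ← fderiv_comp_apply hFA.differentiableAt, hFA.fderiv]
      simp only [ContinuousLinearMap.comp_apply]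
      rw [(hAder z v).2]
    rw [injective_iff_map_eq_zero]
    intro v hv
    have hBv : fderiv ℝ (upd F r w) x (B v) = 0 := by
      have h1 := fderiv_upd F r w x (hS.contDiffAt x hxD) (hw x hxD) (B v)
      funext l
      rcases Fin.eq_self_or_eq_succAbove r l with rfl | ⟨j, rfl⟩
      · rw [h1.1]; exact H2 x hxD hw1 _ (hB0 v)
      · rw [h1.2, ← hF'd, hv]; rfl
    have h2 : B v = 0 := (injective_iff_map_eq_zero _).mp hxi _ hBv
    funext l
    have := congrFun h2 (c.succAbove l)
    simpa [B] using this

end Gale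


namespace Gale
open Set Filter Topology MeasureTheory

/-- `NW` bounds the number of nondegenerate zeros of all systems of type `(n, κ, r)` -/
def Bounds (n κ r : ℕ) (NW : ℝ) : Prop :=
  ∀ (u0 : Fin (n + κ) → ℝ) (u : Fin (n + κ) → Fin κ → ℝ) (F : (Fin κ → ℝ) → (Fin κ → ℝ)),
      IsSys n κ r u0 u F → ∀ Z : Finset (Fin κ → ℝ),
      (∀ z ∈ Z, z ∈ Dom u0 u ∧ F z = 0 ∧ Function.Injective (fderiv ℝ F z)) → (Z.card : ℝ) ≤ NW

theorem fderiv_log_aff {κ N : ℕ} (u0 : Fin N → ℝ) (u : Fin N → Fin κ → ℝ) (i : Fin N) (x v : Fin κ → ℝ)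
    (hx : x ∈ Dom u0 u) : fderiv ℝ (fun y => Real.log (aff u0 u i y)) x v = (∑ l, u i l * v l) / aff u0 u i x := by
  have hd : DifferentiableAt ℝ (aff u0 u i) x := 
    ((polyDeg_contDiff (polyDeg_aff u0 u i) (n := 1)).differentiable one_ne_zero) x
  rw [(hd.hasFDerivAt.log (hx i).ne').fderiv]
  simp only [smul_apply, fderiv_aff, smul_eq_mul]
  rw [div_eq_inv_mul]

theorem wall_single {n k : ℕ} (r : Fin (k+1)) {u0 : Fin (n + (k+1)) → ℝ} {u : Fin (n + (k+1)) → Fin (k+1) → ℝ}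
    {F : (Fin (k+1) → ℝ) → (Fin (k+1) → ℝ)} (hS : IsSys n (k+1) r.val u0 u F)
    (NW : ℝ) (hNW0 : 0 ≤ NW) (hMain : Bounds n k r.val NW)
    (ε : ℝ) (hε : ε * ε = 1) (i : Fin (n + (k+1))) (s : ℝ) (a : Fin k → ℝ)
    (Y : Finset (Fin (k+1) → ℝ))
    (hY : ∀ x ∈ Y, x ∈ Dom u0 u ∧ upd F r (fun y => ε * Real.log (aff u0 u i y)) x = r.insertNth s a ∧ 
      Function.Injective (fderiv ℝ (upd F r (fun y => ε * Real.log (aff u0 u i y))) x)) :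
    (Y.card : ℝ) ≤ NW := by
  have key : ∀ x, u0 i - Real.exp (ε * s) + ∑ l, u i l * x l = 0 → aff u0 u i x = Real.exp (ε * s) := by
    intro x hx; unfold aff; linarith
  refine wall_bound r hS NW hNW0 hMain _ (fun x hx => ?_) s a i (u0 i - Real.exp (ε * s)) (u i) (ε * s) 0 rfl
    ?_ ?_ ?_ ?_ ?_ Y hY
  · exact contDiffAt_const.mul (contDiffAt_log_aff u0 u i x hx)
  · intro x hx hw
    have h1 : Real.log (aff u0 u i x) = ε * s := by
      rw [← hw, ← mul_assoc, hε, one_mul]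
    have h2 : aff u0 u i x = Real.exp (ε * s) := by rw [← h1, Real.exp_log (hx i)]
    unfold aff at h2; linarith
  · intro x hx hw v hv
    rw [fderiv_const_mul ((contDiffAt_log_aff u0 u i x hx (n := 1)).differentiableAt one_ne_zero)]
    simp only [smul_apply, fderiv_log_aff u0 u i x v hx, hv]
    simp
  · intro x hx h
    rw [key x h, Real.log_exp]; simp
  · intro v hv _; exact hv
  · intro x hx _
    rw [key x hx]; exact Real.exp_pos _

theorem wall_pair {n k : ℕ} (r : Fin (k+1)) {u0 : Fin (n + (k+1)) → ℝ} {u : Fin (n + (k+1)) → Fin (k+1) → ℝ}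
    {F : (Fin (k+1) → ℝ) → (Fin (k+1) → ℝ)} (hS : IsSys n (k+1) r.val u0 u F)
    (NW : ℝ) (hNW0 : 0 ≤ NW) (hMain : Bounds n k r.val NW)
    (i i' : Fin (n + (k+1))) (hii : i ≠ i') (s : ℝ) (a : Fin k → ℝ)
    (Y : Finset (Fin (k+1) → ℝ))
    (hY : ∀ x ∈ Y, x ∈ Dom u0 u ∧ upd F r (fun y => Real.log (aff u0 u i y) - Real.log (aff u0 u i' y)) x = r.insertNth s a ∧ 
      Function.Injective (fderiv ℝ (upd F r (fun y => Real.log (aff u0 u i y) - Real.log (aff u0 u i' y))) x)) :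
    (Y.card : ℝ) ≤ NW := by
  set τ := Real.exp s with hτ
  have hsum : ∀ x : Fin (k+1) → ℝ, ∑ l, (u i l - τ * u i' l) * x l = ∑ l, u i l * x l - τ * ∑ l, u i' l * x l := by
    intro x
    rw [Finset.mul_sum, ← Finset.sum_sub_distrib]
    exact Finset.sum_congr rfl fun l _ => by ring
  have key : ∀ x, u0 i - τ * u0 i' + ∑ l, (u i l - τ * u i' l) * x l = aff u0 u i x - τ * aff u0 u i' x := by
    intro x; unfold aff; rw [hsum]; ring
  have hwτ : ∀ x ∈ Dom u0 u, Real.log (aff u0 u i x) - Real.log (aff u0 u i' x) = s →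
      aff u0 u i x = τ * aff u0 u i' x := by
    intro x hx hw
    have h1 : Real.log (aff u0 u i x) = s + Real.log (aff u0 u i' x) := by linarith
    rw [← Real.exp_log (hx i), h1, Real.exp_add, Real.exp_log (hx i')]
  refine wall_bound r hS NW hNW0 hMain _ (fun x hx => ?_) s a i (u0 i - τ * u0 i') (fun l => u i l - τ * u i' l)
    s (Pi.single i' 1) (by simp [hii]) ?_ ?_ ?_ ?_ ?_ Y hY
  · exact (contDiffAt_log_aff u0 u i x hx).sub (contDiffAt_log_aff u0 u i' x hx)
  · intro x hx hw
    rw [key, hwτ x hx hw, sub_self]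
  · intro x hx hw v hv
    rw [hsum] at hv
    rw [fderiv_fun_sub ((contDiffAt_log_aff u0 u i x hx (n := 1)).differentiableAt one_ne_zero)
      ((contDiffAt_log_aff u0 u i' x hx (n := 1)).differentiableAt one_ne_zero)]
    simp only [sub_apply, fderiv_log_aff u0 u _ x v hx]
    have h1 : ∑ l, u i l * v l = τ * ∑ l, u i' l * v l := by linarith
    rw [h1, hwτ x hx hw]
    have := (hx i').ne'
    have h2 : τ ≠ 0 := (Real.exp_pos s).ne'
    field_simp
    ring
  · intro x hx h
    rw [key] at h
    have h1 : aff u0 u i x = τ * aff u0 u i' x := by linarith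
    rw [h1, Real.log_mul (Real.exp_pos s).ne' (hx i').ne', Real.log_exp]
    congr 1
    simp [Pi.single_apply]
  · intro v hv hj
    rw [hsum, hj i' hii.symm] at hv
    linarith
  · intro x hx hj
    rw [key] at hx
    have h1 : aff u0 u i x = τ * aff u0 u i' x := by linarith
    rw [h1]; exact mul_pos (Real.exp_pos s) (hj i' hii.symm)

theorem select {N : ℕ} {ι : Type*} [Fintype ι] (e : ι → Fin N → ℝ) (he : LinearIndependent ℝ e) :
    ∃ B : Finset (Fin N), B.card + Fintype.card ι ≤ N ∧
      ∀ f : Fin N → ℝ, f ∈ Submodule.span ℝ (range e ∪ (fun b => (Pi.single b 1 : Fin N → ℝ)) '' B) := by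
  classical
  have hs : LinearIndepOn ℝ id (range e) := he.linearIndepOn_id
  obtain ⟨b, hbt, hsb, htb, hb⟩ := exists_linearIndepOn_id_extension hs
    (subset_union_left (t := range fun b => (Pi.single b 1 : Fin N → ℝ)))
  have hbfin : b.Finite := hb.setFinite
  have hcard : b.ncard ≤ N := by
    have h1 : Fintype b := hbfin.fintype
    have := LinearIndependent.fintype_card_le_finrank hb
    simp only [Module.finrank_fin_fun] at this
    rw [Set.ncard_eq_toFinset_card' b, Set.toFinset_card]
    exact this
  refine ⟨Finset.univ.filter fun i => (Pi.single i 1 : Fin N → ℝ) ∈ b \ range e, ?_, ?_⟩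
  · set B := Finset.univ.filter fun i => (Pi.single i 1 : Fin N → ℝ) ∈ b \ range e with hB
    have hinj : Function.Injective (fun i => (Pi.single i 1 : Fin N → ℝ)) := fun i j hij => by
      have := congrFun hij i
      by_contra hne
      simp [Pi.single_apply, hne] at this
    have h1 : B.card = (B.image fun i => (Pi.single i 1 : Fin N → ℝ)).card :=
      (Finset.card_image_of_injective _ hinj).symm
    have h2 : Fintype.card ι = (Finset.univ.image e).card := by
      rw [Finset.card_image_of_injective _ he.injective]; rfl
    rw [h1, h2, ← Finset.card_union_of_disjoint]
    · rw [← Set.ncard_coe_finset]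
      refine (Set.ncard_le_ncard ?_ hbfin).trans hcard
      intro x hx
      simp only [Finset.coe_union, Finset.coe_image, mem_union] at hx
      rcases hx with ⟨i, hi, rfl⟩ | ⟨i, hi, rfl⟩
      · simp [hB] at hi; exact hi.1
      · exact hsb ⟨i, rfl⟩
    · rw [Finset.disjoint_left]
      intro x hx hx2
      obtain ⟨i, hi, rfl⟩ := Finset.mem_image.mp hx
      obtain ⟨l, -, hl⟩ := Finset.mem_image.mp hx2
      simp only [hB, Finset.mem_filter] at hi
      exact hi.2.2 ⟨l, hl⟩
  · intro f
    have h1 : b ⊆ range e ∪ (fun b => (Pi.single b 1 : Fin N → ℝ)) ''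
        (Finset.univ.filter fun i => (Pi.single i 1 : Fin N → ℝ) ∈ b \ range e : Finset (Fin N)) := by
      intro x hx
      by_cases hxe : x ∈ range e
      · left; exact hxe
      · right
        rcases hbt hx with h | ⟨i, rfl⟩
        · exact absurd h hxe
        · exact ⟨i, by simpa using ⟨hx, by simpa using hxe⟩, rfl⟩
    apply Submodule.span_mono h1
    have h2 : f = ∑ i, f i • (Pi.single i 1 : Fin N → ℝ) := by
      funext j; simp [Finset.sum_apply, Pi.single_apply]
    rw [h2]
    exact Submodule.sum_mem _ fun i _ => Submodule.smul_mem _ _ (htb (Or.inr ⟨i, rfl⟩))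

theorem bdd_of_span {N : ℕ} (G : Set (Fin N → ℝ)) (S : Set (Fin N → ℝ))
    (hG : ∀ g ∈ G, ∃ C, ∀ X ∈ S, |∑ j, g j * X j| ≤ C) (f : Fin N → ℝ) (hf : f ∈ Submodule.span ℝ G) :
    ∃ C, ∀ X ∈ S, |∑ j, f j * X j| ≤ C := by
  induction hf using Submodule.span_induction with
  | mem x hx => exact hG x hx
  | zero => exact ⟨0, by simp⟩
  | add x y _ _ hx hy =>
    obtain ⟨C, hC⟩ := hx
    obtain ⟨C', hC'⟩ := hy
    refine ⟨C + C', fun X hX => ?_⟩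
    simp only [Pi.add_apply, add_mul, Finset.sum_add_distrib]
    exact (abs_add_le _ _).trans (add_le_add (hC X hX) (hC' X hX))
  | smul a x _ hx =>
    obtain ⟨C, hC⟩ := hx
    refine ⟨|a| * C, fun X hX => ?_⟩
    simp only [Pi.smul_apply, smul_eq_mul, mul_assoc, ← Finset.mul_sum, abs_mul]
    exact mul_le_mul_of_nonneg_left (hC X hX) (abs_nonneg a)

theorem chain_bdd (M : ℕ) (θ : Fin (M+1) → ℝ) : ∃ C, ∀ L : ℕ → ℝ, L 0 = 0 → L (M+1) = 0 →
    (∀ t : Fin (M+1), θ t ≤ L t.val - L (t.val + 1)) → ∀ t, t ≤ M + 1 → |L t| ≤ C := by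
  obtain ⟨c, hc0, hc⟩ : ∃ c : ℝ, 0 ≤ c ∧ ∀ t, |θ t| ≤ c := by
    refine ⟨∑ t, |θ t|, Finset.sum_nonneg fun _ _ => abs_nonneg _, fun t => ?_⟩
    exact Finset.single_le_sum (f := fun t => |θ t|) (fun _ _ => abs_nonneg _) (Finset.mem_univ t)
  refine ⟨(M+1) * c, fun L h0 h1 h => ?_⟩
  have hstep : ∀ t, t < M + 1 → L (t+1) ≤ L t + c := by
    intro t ht
    have := h ⟨t, ht⟩
    have h2 := (abs_le.mp (hc ⟨t, ht⟩)).1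
    simp only at this
    linarith
  have hup : ∀ t, t ≤ M + 1 → L t ≤ t * c := by
    intro t
    induction t with
    | zero => intro _; simp [h0]
    | succ t ih =>
      intro ht
      have := hstep t (by omega)
      have := ih (by omega)
      push_cast; linarith
  have hdown : ∀ d, d ≤ M + 1 → - (d * c) ≤ L (M + 1 - d) := by
    intro d
    induction d with
    | zero => intro _; simp [h1]
    | succ d ih =>
      intro hd
      have h2 := hstep (M + 1 - (d+1)) (by omega)
      have h3 : M + 1 - (d+1) + 1 = M + 1 - d := by omega
      rw [h3] at h2
      have := ih (by omega)
      rw [Nat.cast_add, Nat.cast_one]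
      linarith
  intro t ht
  rw [abs_le]
  constructor
  · have h2 := hdown (M + 1 - t) (by omega)
    have h3 : M + 1 - (M + 1 - t) = t := by omega
    rw [h3] at h2
    have h4 : ((M + 1 - t : ℕ) : ℝ) ≤ M + 1 := by
      have : M + 1 - t ≤ M + 1 := by omega
      exact_mod_cast this
    have := mul_le_mul_of_nonneg_right h4 hc0
    linarith
  · have h4 : (t : ℝ) ≤ M + 1 := by exact_mod_cast ht
    have := mul_le_mul_of_nonneg_right h4 hc0
    linarith [hup t ht]

theorem compact_box {κ N : ℕ} (u0 : Fin N → ℝ) (u : Fin N → Fin κ → ℝ)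
    (hinj : ∀ v : Fin κ → ℝ, (∀ i, ∑ l, u i l * v l = 0) → v = 0) (lo hi : ℝ) :
    IsCompact {y : Fin κ → ℝ | ∀ i, lo ≤ aff u0 u i y ∧ aff u0 u i y ≤ hi} := by
  let U : (Fin κ → ℝ) →ₗ[ℝ] (Fin N → ℝ) := Matrix.toLin' (Matrix.of u)
  have hU : ∀ y i, U y i = ∑ l, u i l * y l := by
    intro y i
    simp [U, Matrix.toLin'_apply, Matrix.mulVec, dotProduct]
  have hk : U.ker = ⊥ := by
    rw [LinearMap.ker_eq_bot']
    intro v hv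
    apply hinj
    intro i
    rw [← hU, hv]; rfl
  have hce := LinearMap.isClosedEmbedding_of_injective hk
  have hc : IsCompact (Set.pi univ fun i => Icc (lo - u0 i) (hi - u0 i)) :=
    isCompact_univ_pi fun i => isCompact_Icc
  have := hce.isCompact_preimage hc
  convert this using 1
  ext y
  simp only [mem_preimage, Set.mem_pi, mem_univ, true_implies, mem_Icc, hU, Set.mem_ofPred_eq, aff]
  refine forall_congr' fun i => ?_
  constructor <;> rintro ⟨h1, h2⟩ <;> constructor <;> linarith

end Gale


namespace Gale
open Set Filter Topology MeasureTheory

theorem Bounds.nonneg {n κ r : ℕ} {NW : ℝ} (h : Bounds n κ r NW) {u0 : Fin (n + κ) → ℝ} {u : Fin (n + κ) → Fin κ → ℝ}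
    {F : (Fin κ → ℝ) → (Fin κ → ℝ)} (hS : IsSys n κ r u0 u F) : 0 ≤ NW := by
  have := h u0 u F hS ∅ (by simp)
  simpa using this

/-- chain functions -/
noncomputable def chn {κ N M : ℕ} (u0 : Fin N → ℝ) (u : Fin N → Fin κ → ℝ) (b : Fin M → Fin N) (t : ℕ) (y : Fin κ → ℝ) : ℝ :=
  if h : 1 ≤ t ∧ t ≤ M then Real.log (aff u0 u (b ⟨t - 1, by omega⟩) y) else 0

theorem chn_contDiffAt {κ N M : ℕ} (u0 : Fin N → ℝ) (u : Fin N → Fin κ → ℝ) (b : Fin M → Fin N) (t : ℕ) (x : Fin κ → ℝ)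
    (hx : x ∈ Dom u0 u) : ContDiffAt ℝ 1 (chn u0 u b t) x := by
  unfold chn
  by_cases h : 1 ≤ t ∧ t ≤ M
  · simp only [dif_pos h]; exact contDiffAt_log_aff u0 u _ x hx
  · simp only [dif_neg h]; exact contDiffAt_const

theorem zero_not_inj {k : ℕ} (r : Fin (k+1)) (F : (Fin (k+1) → ℝ) → (Fin (k+1) → ℝ)) (x : Fin (k+1) → ℝ)
    (hF : ContDiffAt ℝ 1 F x) : ¬ Function.Injective (fderiv ℝ (upd F r (fun _ => 0)) x) := by
  intro hxi
  obtain ⟨v, hv⟩ := (LinearMap.injective_iff_surjective 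
    (f := (fderiv ℝ (upd F r (fun _ => 0)) x : (Fin (k+1) → ℝ) →ₗ[ℝ] (Fin (k+1) → ℝ)))).mp hxi (Pi.single r 1)
  have h1 := (fderiv_upd F r (fun _ => 0) x hF contDiffAt_const v).1
  have h3 := congrFun hv r
  simp only [ContinuousLinearMap.coe_coe] at h3
  rw [h1] at h3
  simp at h3

theorem chain_wall {n k M : ℕ} (r : Fin (k+1)) {u0 : Fin (n + (k+1)) → ℝ} {u : Fin (n + (k+1)) → Fin (k+1) → ℝ}
    {F : (Fin (k+1) → ℝ) → (Fin (k+1) → ℝ)} (hS : IsSys n (k+1) r.val u0 u F)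
    (NW : ℝ) (hNW0 : 0 ≤ NW) (hMain : Bounds n k r.val NW) (b : Fin M → Fin (n + (k+1))) (hb : Function.Injective b)
    (t : ℕ) (ht : t ≤ M) (s : ℝ) (a : Fin k → ℝ)
    (Y : Finset (Fin (k+1) → ℝ))
    (hY : ∀ x ∈ Y, x ∈ Dom u0 u ∧ upd F r (fun y => chn u0 u b t y - chn u0 u b (t+1) y) x = r.insertNth s a ∧ 
      Function.Injective (fderiv ℝ (upd F r (fun y => chn u0 u b t y - chn u0 u b (t+1) y)) x)) :
    (Y.card : ℝ) ≤ NW := by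
  unfold chn at hY
  by_cases h1 : 1 ≤ t ∧ t ≤ M
  · by_cases h2 : 1 ≤ t + 1 ∧ t + 1 ≤ M
    · simp only [dif_pos h1, dif_pos h2] at hY
      refine wall_pair r hS NW hNW0 hMain _ _ ?_ s a Y hY
      intro h
      have := hb h
      simp only [Fin.mk.injEq] at this
      omega
    · simp only [dif_pos h1, dif_neg h2] at hY
      have h3 : (fun y => Real.log (aff u0 u (b ⟨t - 1, by omega⟩) y) - 0) =
        fun y => 1 * Real.log (aff u0 u (b ⟨t - 1, by omega⟩) y) := by funext y; ring
      rw [h3] at hY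
      exact wall_single r hS NW hNW0 hMain 1 (by norm_num) _ s a Y hY
  · by_cases h2 : 1 ≤ t + 1 ∧ t + 1 ≤ M
    · simp only [dif_neg h1, dif_pos h2] at hY
      have h3 : (fun y => 0 - Real.log (aff u0 u (b ⟨t + 1 - 1, by omega⟩) y)) =
        fun y => -1 * Real.log (aff u0 u (b ⟨t + 1 - 1, by omega⟩) y) := by funext y; ring
      rw [h3] at hY
      exact wall_single r hS NW hNW0 hMain (-1) (by norm_num) _ s a Y hY
    · simp only [dif_neg h1, dif_neg h2, sub_self] at hY
      rcases Y.eq_empty_or_nonempty with rfl | ⟨x, hx⟩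
      · simpa using hNW0
      · exact absurd (hY x hx).2.2 (zero_not_inj r F x (hS.contDiffAt x (hY x hx).1))

theorem Q_bound {n k : ℕ} (r : Fin (k+1)) {u0 : Fin (n + (k+1)) → ℝ} {u : Fin (n + (k+1)) → Fin (k+1) → ℝ}
    {F : (Fin (k+1) → ℝ) → (Fin (k+1) → ℝ)} (hS : IsSys n (k+1) r.val u0 u F)
    (NQ : ℝ) (hMain : Bounds n (k+1) (r.val + 1) NQ) (Q : (Fin (k+1) → ℝ) → ℝ) (hQ : PolyDeg (n * 2 ^ r.val) Q)
    (s : ℝ) (a : Fin k → ℝ)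
    (Y : Finset (Fin (k+1) → ℝ))
    (hY : ∀ x ∈ Y, x ∈ Dom u0 u ∧ upd F r Q x = r.insertNth s a ∧ 
      Function.Injective (fderiv ℝ (upd F r Q) x)) :
    (Y.card : ℝ) ≤ NQ := by
  set d : Fin (k+1) → ℝ := r.insertNth s a with hd
  have hS' : IsSys n (k+1) (r.val + 1) u0 u (fun y => upd F r Q y - d) := by
    refine ⟨hS.inj, ?_, ?_⟩
    · intro l hl
      rcases Fin.eq_self_or_eq_succAbove r l with rfl | ⟨j, rfl⟩
      · exact (hQ.add (polyDeg_const (-d l))).congr fun y => by simp [upd_same, sub_eq_add_neg]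
      · have h1 : (r.succAbove j).val < r.val := by
          have := Fin.succAbove_ne r j
          have h2 : (r.succAbove j).val ≠ r.val := fun h => this (Fin.ext h)
          omega
        exact ((hS.poly _ h1).add (polyDeg_const (-d (r.succAbove j)))).congr fun y => by
          simp [upd_succAbove, sub_eq_add_neg]
    · intro l hl
      rcases Fin.eq_self_or_eq_succAbove r l with rfl | ⟨j, rfl⟩
      · omega
      · obtain ⟨e, c, hec⟩ := hS.log (r.succAbove j) (by omega)
        refine ⟨e, c + d (r.succAbove j), fun y hy => ?_⟩
        simp only [Pi.sub_apply, upd_succAbove, hec y hy]; ring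
  apply hMain u0 u _ hS'
  intro z hz
  obtain ⟨h1, h2, h3⟩ := hY z hz
  refine ⟨h1, ?_, ?_⟩
  · simp only [h2, sub_self]
  · rw [fderiv_sub_const]; exact h3

theorem sys_step {n k : ℕ} (hn : 1 ≤ n) (r : Fin (k+1)) (NQ NW : ℝ) (hNW0 : 0 ≤ NW) (hNQ0 : 0 ≤ NQ)
    (hNQ : Bounds n (k+1) (r.val + 1) NQ) (hNW : Bounds n k r.val NW) :
    Bounds n (k+1) r.val (NQ + (n + r.val + 2) / 2 * NW) := by
  classical
  intro u0 u F hS Z hZ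
  rcases Z.eq_empty_or_nonempty with rfl | ⟨z0, hz0⟩
  · simp; positivity
  obtain ⟨Q, hQd, hQJ⟩ := exists_Q hn (by omega : r.val ≤ k + 1) hS
  -- selection of `B`
  have hlog : ∀ l : {l : Fin (k+1) // r.val < l.val}, ∃ (e : Fin (n + (k+1)) → ℝ) (c : ℝ),
      ∀ y ∈ Dom u0 u, F y l.1 = lg u0 u e y - c := fun l => hS.log l.1 l.2.le
  choose e c hec using hlog
  have hli : LinearIndependent ℝ e := by
    rw [Fintype.linearIndependent_iff]
    intro g hg l
    obtain ⟨hzD, -, hzi⟩ := hZ z0 hz0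
    obtain ⟨v, hv⟩ := (LinearMap.injective_iff_surjective 
      (f := (fderiv ℝ F z0 : (Fin (k+1) → ℝ) →ₗ[ℝ] (Fin (k+1) → ℝ)))).mp hzi (Pi.single l.1 1)
    simp only [ContinuousLinearMap.coe_coe] at hv
    have hd : DifferentiableAt ℝ F z0 := (hS.contDiffAt z0 hzD (N := 1)).differentiableAt one_ne_zero
    have h1 : ∑ l', g l' * fderiv ℝ F z0 v l'.1 = 0 := by
      have h2 : ∀ l', fderiv ℝ F z0 v l'.1 = ∑ i, e l' i / aff u0 u i z0 * ∑ l, u i l * v l := fun l' => by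
        rw [fderiv_comp_apply hd, fderiv_log_row (hec l') z0 v hzD]
      simp only [h2, Finset.mul_sum]
      rw [Finset.sum_comm]
      apply Finset.sum_eq_zero
      intro i _
      rw [Finset.sum_comm]
      apply Finset.sum_eq_zero
      intro c' _
      have h3 := congrFun hg i
      simp only [Finset.sum_apply, Pi.smul_apply, smul_eq_mul, Pi.zero_apply] at h3
      have h4 : ∑ x, g x * (e x i / aff u0 u i z0 * (u i c' * v c')) = (∑ x, g x * e x i) * ((u i c' * v c') / aff u0 u i z0) := by
        rw [Finset.sum_mul]; exact Finset.sum_congr rfl fun x _ => by ring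
      rw [h4, h3, zero_mul]
    rw [hv, Finset.sum_eq_single l] at h1
    · simpa using h1
    · intro b _ hb
      rw [Pi.single_eq_of_ne (fun h => hb (Subtype.ext h)), mul_zero]
    · simp
  obtain ⟨B, hBc, hBs⟩ := select e hli
  have hcι : Fintype.card {l : Fin (k+1) // r.val < l.val} = k - r.val := by
    rw [Fintype.card_subtype]
    have h3 := Finset.card_filter_add_card_filter_not (s := (Finset.univ : Finset (Fin (k+1)))) (fun l : Fin (k+1) => l.val < r.val + 1)
    simp only [not_lt, Finset.card_univ, Fintype.card_fin] at h3
    have h4 : (Finset.univ.filter (fun l : Fin (k+1) => l.val < r.val + 1)).card = r.val + 1 := by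
      rw [Fin.card_filter_val_lt]; omega
    have h5 : (Finset.univ.filter (fun l : Fin (k+1) => r.val < l.val)) = Finset.univ.filter (fun l : Fin (k+1) => r.val + 1 ≤ l.val) := rfl
    rw [h5]
    omega
  set M := B.card with hM
  have hMle : M ≤ n + r.val + 1 := by omega
  let b : Fin M → Fin (n + (k+1)) := fun t => (B.orderEmbOfFin rfl t)
  have hbinj : Function.Injective b := (B.orderEmbOfFin rfl).injective
  let w : Fin (M+1) → (Fin (k+1) → ℝ) → ℝ := fun t y => chn u0 u b t.val y - chn u0 u b (t.val+1) y
  have hw : ∀ t, ∀ x ∈ Dom u0 u, ContDiffAt ℝ 1 (w t) x := fun t x hx =>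
    (chn_contDiffAt u0 u b t.val x hx).sub (chn_contDiffAt u0 u b (t.val+1) x hx)
  have hproper : ∀ (a : Fin k → ℝ) (θ : Fin (M+1) → ℝ),
      IsCompact {x | x ∈ Dom u0 u ∧ (∀ l, F x (r.succAbove l) = a l) ∧ ∀ t, θ t ≤ w t x} := by
    intro a θ
    set K := {x | x ∈ Dom u0 u ∧ (∀ l, F x (r.succAbove l) = a l) ∧ ∀ t, θ t ≤ w t x} with hK
    set S : Set (Fin (n + (k+1)) → ℝ) := (fun x i => Real.log (aff u0 u i x)) '' K with hSdef
    obtain ⟨C0, hC0⟩ := chain_bdd M θ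
    have hgen : ∀ g ∈ range e ∪ (fun b => (Pi.single b 1 : Fin (n + (k+1)) → ℝ)) '' B,
        ∃ C, ∀ X ∈ S, |∑ j, g j * X j| ≤ C := by
      rintro g (⟨l, rfl⟩ | ⟨i, hi, rfl⟩)
      · obtain ⟨j, hj⟩ : ∃ j, r.succAbove j = l.1 := Fin.exists_succAbove_eq (fun h => by
          have h2 := l.2
          have h3 : l.1.val = r.val := congrArg Fin.val h
          omega)
        refine ⟨|a j + c l|, ?_⟩
        rintro X ⟨x, hx, rfl⟩
        have h1 := hec l x hx.1
        have h0 := hx.2.1 j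
        rw [hj] at h0
        rw [h0] at h1
        unfold lg at h1
        have h2 : ∑ j, e l j * Real.log (aff u0 u j x) = a j + c l := by linarith
        rw [h2]
      · refine ⟨C0, ?_⟩
        rintro X ⟨x, hx, rfl⟩
        have h1 : ∑ j, (Pi.single i 1 : Fin (n + (k+1)) → ℝ) j * Real.log (aff u0 u j x) = Real.log (aff u0 u i x) := by
          simp [Pi.single_apply]
        rw [h1]
        have h2 : i ∈ range (B.orderEmbOfFin rfl) := by rw [Finset.range_orderEmbOfFin]; exact hi
        obtain ⟨t, ht⟩ := h2
        have h3 := hC0 (fun t => chn u0 u b t x) (by simp [chn]) (by simp [chn]) (fun t => hx.2.2 t) (t.val + 1) (by omega)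
        have h4 : chn u0 u b (t.val + 1) x = Real.log (aff u0 u i x) := by
          unfold chn
          rw [dif_pos ⟨by omega, by omega⟩]
          have : b ⟨t.val + 1 - 1, by omega⟩ = i := ht
          rw [this]
        simp only [h4] at h3
        exact h3
    have hbd : ∀ i, ∃ C, ∀ x ∈ K, |Real.log (aff u0 u i x)| ≤ C := by
      intro i
      obtain ⟨C, hC⟩ := bdd_of_span _ S hgen (Pi.single i 1) (hBs _)
      refine ⟨C, fun x hx => ?_⟩
      have := hC _ ⟨x, hx, rfl⟩
      simpa [Pi.single_apply] using this
    choose C hC using hbd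
    set C1 := ∑ i, |C i| with hC1
    have hbd2 : ∀ i, ∀ x ∈ K, |Real.log (aff u0 u i x)| ≤ C1 := fun i x hx =>
      (hC i x hx).trans ((le_abs_self _).trans
        (Finset.single_le_sum (f := fun i => |C i|) (fun _ _ => abs_nonneg _) (Finset.mem_univ i)))
    have hcomp := compact_box u0 u hS.inj (Real.exp (-C1)) (Real.exp C1)
    set K' := {y : Fin (k+1) → ℝ | ∀ i, Real.exp (-C1) ≤ aff u0 u i y ∧ aff u0 u i y ≤ Real.exp C1} with hK'
    have hK'D : ∀ x ∈ K', x ∈ Dom u0 u := fun x hx i => (Real.exp_pos _).trans_le (hx i).1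
    have hKK' : K ⊆ K' := by
      intro x hx i
      have h1 := abs_le.mp (hbd2 i x hx)
      rw [← Real.exp_log (hx.1 i)]
      exact ⟨Real.exp_le_exp.mpr h1.1, Real.exp_le_exp.mpr h1.2⟩
    have hKeq : K = (⋂ l, (K' ∩ (fun x => F x (r.succAbove l)) ⁻¹' {a l})) ∩ (⋂ t, (K' ∩ (w t) ⁻¹' Ici (θ t))) := by
      ext x
      simp only [mem_inter_iff, mem_iInter, mem_preimage, mem_singleton_iff, mem_Ici]
      constructor
      · intro hx
        exact ⟨fun l => ⟨hKK' hx, hx.2.1 l⟩, fun t => ⟨hKK' hx, hx.2.2 t⟩⟩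
      · rintro ⟨h1, h2⟩
        exact ⟨hK'D x (h2 0).1, fun l => (h1 l).2, fun t => (h2 t).2⟩
    refine hcomp.of_isClosed_subset ?_ hKK'
    rw [hKeq]
    refine IsClosed.inter (isClosed_iInter fun l => ?_) (isClosed_iInter fun t => ?_)
    · refine ContinuousOn.preimage_isClosed_of_isClosed (fun x hx => ?_) hcomp.isClosed isClosed_singleton
      exact ((continuous_apply (r.succAbove l)).continuousAt.comp (hS.contDiffAt x (hK'D x hx) (N := 1)).continuousAt).continuousWithinAt
    · refine ContinuousOn.preimage_isClosed_of_isClosed (fun x hx => ?_) hcomp.isClosed isClosed_Ici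
      exact (hw t x (hK'D x hx)).continuousAt.continuousWithinAt
  have hfin := step k r (Dom u0 u) (isOpen_Dom u0 u) F (fun x hx => hS.contDiffAt x hx) Q
    (fun x _ => (polyDeg_contDiff hQd).contDiffAt) hQJ (M+1) w hw hproper NQ NW
    (fun s a Y hY => Q_bound r hS NQ hNQ Q hQd s a Y hY)
    (fun t s a Y hY => chain_wall r hS NW hNW0 hNW b hbinj t.val (by omega) s a Y hY) Z hZ
  refine hfin.trans ?_
  have h1 : ((M + 1 : ℕ) : ℝ) ≤ n + r.val + 2 := by
    have : M + 1 ≤ n + r.val + 2 := by omega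
    exact_mod_cast this
  have h2 : ((M + 1 : ℕ) : ℝ) / 2 * NW ≤ (n + r.val + 2) / 2 * NW := by
    apply mul_le_mul_of_nonneg_right _ hNW0
    linarith
  linarith

end Gale


namespace Gale
open Set Filter Topology MeasureTheory

theorem interp {r : ℕ} (Z : Finset (Fin r → ℝ)) (z : Fin r → ℝ) (hz : z ∈ Z) :
    ∃ p : MvPolynomial (Fin r) ℝ, p.totalDegree ≤ Z.card ∧ MvPolynomial.eval z p = 1 ∧
      ∀ w ∈ Z, w ≠ z → MvPolynomial.eval w p = 0 := by
  classical
  have h : ∀ w : Fin r → ℝ, ∃ q : MvPolynomial (Fin r) ℝ, q.totalDegree ≤ 1 ∧ (w ≠ z → MvPolynomial.eval z q = 1 ∧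
      MvPolynomial.eval w q = 0) := by
    intro w
    by_cases hw : w = z
    · exact ⟨0, by simp, fun h => absurd hw h⟩
    · obtain ⟨c, hc⟩ : ∃ c, w c ≠ z c := by
        by_contra hcon
        push Not at hcon
        exact hw (funext hcon)
      have hc' : z c - w c ≠ 0 := sub_ne_zero.mpr (Ne.symm hc)
      refine ⟨MvPolynomial.C (z c - w c)⁻¹ * (MvPolynomial.X c - MvPolynomial.C (w c)), ?_, fun _ => ⟨?_, ?_⟩⟩
      · refine (MvPolynomial.totalDegree_mul _ _).trans ?_
        simp only [MvPolynomial.totalDegree_C, zero_add]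
        exact (MvPolynomial.totalDegree_sub_C_le _ _).trans (by simp)
      · simp [hc']
      · simp
  choose q hq1 hq2 using h
  refine ⟨∏ w ∈ Z.erase z, q w, ?_, ?_, ?_⟩
  · refine (MvPolynomial.totalDegree_finsetProd _ _).trans ?_
    refine (Finset.sum_le_sum fun w _ => hq1 w).trans ?_
    simpa using Finset.card_le_card (Finset.erase_subset z Z)
  · rw [map_prod]
    exact Finset.prod_eq_one fun w hw => (hq2 w (Finset.ne_of_mem_erase hw)).1
  · intro w hw hwz
    rw [map_prod]
    exact Finset.prod_eq_zero (Finset.mem_erase.mpr ⟨hwz, hw⟩) (hq2 w hwz).2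

theorem bez_alg {r : ℕ} (N : ℕ) (d : Fin r → ℕ) (f : Fin r → MvPolynomial (Fin r) ℝ)
    (hf : ∀ l, (f l).totalDegree ≤ d l) :
    ∃ T : Set ℝ, T.Finite ∧ ∀ s, s ∉ T → ∀ Z : Finset (Fin r → ℝ), Z.card = N →
      (∀ z ∈ Z, ∀ l, s * z l ^ d l = MvPolynomial.eval z (f l)) → Z.card ≤ ∏ l, d l := by
  classical
  -- the reduction map
  let g : (Fin r →₀ ℕ) → MvPolynomial (Fin r) ℝ := fun m =>
    if h : ∃ l, d l ≤ m l then f h.choose * MvPolynomial.monomial (m - Finsupp.single h.choose (d h.choose)) 1 else 0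
  let A : MvPolynomial (Fin r) ℝ →ₗ[ℝ] MvPolynomial (Fin r) ℝ := (MvPolynomial.basisMonomials (Fin r) ℝ).constr ℝ g
  have hAm : ∀ m, A (MvPolynomial.monomial m 1) = g m := by
    intro m
    have := (MvPolynomial.basisMonomials (Fin r) ℝ).constr_basis ℝ g m
    rwa [MvPolynomial.coe_basisMonomials] at this
  have hgd : ∀ m, (g m).totalDegree ≤ m.degree := by
    intro m
    simp only [g]
    split_ifs with h
    · refine (MvPolynomial.totalDegree_mul _ _).trans ?_
      have h1 := hf h.choose
      have h2 := MvPolynomial.totalDegree_monomial_le (m - Finsupp.single h.choose (d h.choose)) (1:ℝ)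
      have h3 : (m - Finsupp.single h.choose (d h.choose)) + Finsupp.single h.choose (d h.choose) = m := by
        apply tsub_add_cancel_of_le
        rw [Finsupp.single_le_iff]; exact h.choose_spec
      have h4 := congrArg Finsupp.degree h3
      rw [map_add, Finsupp.degree_single] at h4
      have h5 : (m - Finsupp.single h.choose (d h.choose)).sum (fun _ => id) = (m - Finsupp.single h.choose (d h.choose)).degree := rfl
      omega
    · simp
  set V := MvPolynomial.restrictTotalDegree (Fin r) ℝ N with hV
  have hAV : ∀ p ∈ V, A p ∈ V := by
    intro p hp
    rw [hV, MvPolynomial.mem_restrictTotalDegree] at hp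
    rw [MvPolynomial.as_sum p, map_sum]
    refine Submodule.sum_mem _ fun m hm => ?_
    have : MvPolynomial.monomial m (p.coeff m) = p.coeff m • MvPolynomial.monomial m (1:ℝ) := by
      rw [MvPolynomial.smul_monomial]; simp
    rw [this, map_smul, hAm]
    refine Submodule.smul_mem _ _ ?_
    rw [hV, MvPolynomial.mem_restrictTotalDegree]
    exact (hgd m).trans ((MvPolynomial.le_totalDegree hm).trans hp)
  let A' : Module.End ℝ V := A.restrict hAV
  refine ⟨spectrum ℝ A', Module.End.finite_spectrum A', ?_⟩
  intro s hs Z hZN hZ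
  have hu : IsUnit (algebraMap ℝ (Module.End ℝ V) s - A') := spectrum.notMem_iff.mp hs
  have hsurj : Function.Surjective (algebraMap ℝ (Module.End ℝ V) s - A') := ((Module.End.isUnit_iff _).mp hu).2
  let ev : MvPolynomial (Fin r) ℝ →ₗ[ℝ] (Z → ℝ) := LinearMap.pi fun z => (MvPolynomial.aeval (R := ℝ) z.1).toLinearMap
  have hev : ∀ p z, ev p z = MvPolynomial.eval z.1 p := fun p z => by
    simp [ev, MvPolynomial.aeval_eq_eval]
  let β : (∀ l, Fin (d l)) → (Fin r →₀ ℕ) := fun b => Finsupp.equivFunOnFinite.symm fun l => (b l).val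
  let T : ((∀ l, Fin (d l)) → ℝ) →ₗ[ℝ] (Z → ℝ) :=
    Fintype.linearCombination ℝ (fun b => ev (MvPolynomial.monomial (β b) s))
  have hT : ∀ b, ev (MvPolynomial.monomial (β b) s) ∈ LinearMap.range T := fun b =>
    ⟨Pi.single b 1, by simp [T]⟩
  have hall : ∀ p : MvPolynomial (Fin r) ℝ, ev (s • p - A p) ∈ LinearMap.range T := by
    intro p
    have h0 : (⊤ : Submodule ℝ (MvPolynomial (Fin r) ℝ)) ≤ (LinearMap.range T).comap (ev ∘ₗ (s • LinearMap.id - A)) := by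
      rw [← (MvPolynomial.basisMonomials (Fin r) ℝ).span_eq, Submodule.span_le]
      rintro _ ⟨m, rfl⟩
      rw [MvPolynomial.coe_basisMonomials]
      simp only [SetLike.mem_coe, Submodule.mem_comap, LinearMap.comp_apply, LinearMap.sub_apply, LinearMap.smul_apply, LinearMap.id_apply, hAm]
      by_cases h : ∃ l, d l ≤ m l
      · have h3 : (m - Finsupp.single h.choose (d h.choose)) + Finsupp.single h.choose (d h.choose) = m := by
          apply tsub_add_cancel_of_le
          rw [Finsupp.single_le_iff]; exact h.choose_spec
        have h1 : ev (s • MvPolynomial.monomial m 1 - g m) = 0 := by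
          funext z
          rw [hev, Pi.zero_apply, map_sub]
          simp only [g, dif_pos h, map_mul]
          rw [← hZ z.1 z.2]
          have h4 : MvPolynomial.monomial m (1:ℝ) = MvPolynomial.monomial (m - Finsupp.single h.choose (d h.choose)) 1 * 
            MvPolynomial.monomial (Finsupp.single h.choose (d h.choose)) 1 := by
            rw [MvPolynomial.monomial_mul, h3, one_mul]
          rw [h4, MvPolynomial.smul_eval, map_mul]
          rw [MvPolynomial.eval_monomial (s := Finsupp.single h.choose (d h.choose))]
          rw [Finsupp.prod_single_index (by simp)]
          ring
        rw [h1]; exact Submodule.zero_mem _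
      · push Not at h
        have h1 : g m = 0 := by
          simp only [g]; rw [dif_neg]; push Not; exact h
        have h2 : β (fun l => ⟨m l, h l⟩) = m := by ext l; simp [β]
        have h3 := hT (fun l => ⟨m l, h l⟩)
        rw [h2] at h3
        rw [h1, sub_zero, MvPolynomial.smul_monomial]
        simpa using h3
    exact h0 (Submodule.mem_top (x := p))
  have hTs : Function.Surjective T := by
    rw [← LinearMap.range_eq_top, eq_top_iff]
    intro φ _
    have hφ : φ = ∑ z, φ z • (Pi.single z 1 : Z → ℝ) := by
      funext w; simp [Finset.sum_apply, Pi.single_apply]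
    rw [hφ]
    refine Submodule.sum_mem _ fun z _ => Submodule.smul_mem _ _ ?_
    obtain ⟨p, hp1, hp2, hp3⟩ := interp Z z.1 z.2
    have hpV : p ∈ V := by rw [hV, MvPolynomial.mem_restrictTotalDegree]; omega
    obtain ⟨q, hq⟩ := hsurj ⟨p, hpV⟩
    have h1 : s • q.1 - A q.1 = p := by
      have := congrArg Subtype.val hq
      simpa [A'] using this
    have h2 := hall q.1
    rw [h1] at h2
    convert h2 using 1
    funext w
    rw [hev]
    by_cases hw : w = z
    · subst hw; simp [hp2]
    · rw [Pi.single_eq_of_ne hw, hp3 w.1 w.2 (fun h => hw (Subtype.ext h))]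
  have := LinearMap.finrank_le_finrank_of_surjective hTs
  simpa using this

end Gale


namespace Gale
open Set Filter Topology MeasureTheory

theorem bezout {r : ℕ} (d : Fin r → ℕ) (F : (Fin r → ℝ) → (Fin r → ℝ)) (hF : ∀ l, PolyDeg (d l) (fun y => F y l))
    (Z : Finset (Fin r → ℝ)) (hZ : ∀ z ∈ Z, F z = 0 ∧ Function.Injective (fderiv ℝ F z)) :
    Z.card ≤ ∏ l, d l := by
  classical
  choose f hfd hf using hF
  obtain ⟨T, hTf, hT⟩ := bez_alg Z.card d f hfd
  let pw : (Fin r → ℝ) → (Fin r → ℝ) := fun x l => x l ^ d l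
  have hpw : ContDiff ℝ 1 pw := by fun_prop
  have hFc : ContDiff ℝ 1 F := by
    rw [contDiff_pi]
    intro l
    exact polyDeg_contDiff (d := d l) ⟨f l, hfd l, hf l⟩
  let Φ : (Fin r → ℝ) × ℝ → (Fin r → ℝ) × ℝ := fun q => (F q.1 - q.2 • pw q.1, q.2)
  have hΦ : ContDiff ℝ 1 Φ := by fun_prop
  let ι : (Fin r → ℝ) ↪ (Fin r → ℝ) × ℝ := ⟨fun z => (z, 0), fun a b h => (Prod.mk.inj h).1⟩
  have hinj : ∀ z ∈ Z, Function.Injective (fderiv ℝ Φ (z, 0)) := by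
    intro z hz
    have h1 : HasFDerivAt F (fderiv ℝ F z) z := ((hFc.differentiable one_ne_zero) z).hasFDerivAt
    have h2 : HasFDerivAt pw (fderiv ℝ pw z) z := ((hpw.differentiable one_ne_zero) z).hasFDerivAt
    have h3 : HasFDerivAt (fun q : (Fin r → ℝ) × ℝ => F q.1) ((fderiv ℝ F z).comp (ContinuousLinearMap.fst ℝ _ _)) (z, (0:ℝ)) :=
      HasFDerivAt.comp (g := F) (f := Prod.fst) (z, (0:ℝ)) h1 hasFDerivAt_fst
    have h4 : HasFDerivAt (fun q : (Fin r → ℝ) × ℝ => pw q.1) ((fderiv ℝ pw z).comp (ContinuousLinearMap.fst ℝ _ _)) (z, (0:ℝ)) :=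
      HasFDerivAt.comp (g := pw) (f := Prod.fst) (z, (0:ℝ)) h2 hasFDerivAt_fst
    have h5 : HasFDerivAt (fun q : (Fin r → ℝ) × ℝ => q.2) (ContinuousLinearMap.snd ℝ (Fin r → ℝ) ℝ) (z, (0:ℝ)) := hasFDerivAt_snd
    have h6 := (h3.fun_sub (h5.fun_smul h4)).prodMk h5
    have h7 : fderiv ℝ Φ (z, 0) = _ := h6.fderiv
    rw [h7]
    refine (injective_iff_map_eq_zero _).mpr ?_
    rintro ⟨v, τ⟩ hv
    simp at hv
    obtain ⟨hv1, rfl⟩ := hv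
    simp at hv1
    have := (injective_iff_map_eq_zero _).mp (hZ z hz).2 v hv1
    rw [this]; rfl
  have hp := persist univ isOpen_univ Φ (fun x _ => hΦ.contDiffAt) (Z.map ι) (0, 0) (by
    intro q hq
    obtain ⟨z, hz, rfl⟩ := Finset.mem_map.mp hq
    refine ⟨mem_univ _, ?_, hinj z hz⟩
    change (F z - (0:ℝ) • pw z, (0:ℝ)) = (0, 0)
    rw [(hZ z hz).1]; simp)
  have hc : Tendsto (fun s : ℝ => ((0 : Fin r → ℝ), s)) (𝓝 0) (𝓝 (0, 0)) := by
    apply Continuous.tendsto'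
    · fun_prop
    · rfl
  have hp2 := hc.eventually hp
  have hp3 : ∀ᶠ s in 𝓝[≠] (0:ℝ), s ∉ T := by
    have : (T \ {0}).Finite := hTf.subset sdiff_subset
    have h8 : (T \ {0})ᶜ ∈ 𝓝 (0:ℝ) := this.isClosed.isOpen_compl.mem_nhds (by simp)
    filter_upwards [mem_nhdsWithin_of_mem_nhds h8, self_mem_nhdsWithin] with s hs hs0 hsT
    exact hs ⟨hsT, hs0⟩
  obtain ⟨s, hs, Z', hZc, hZ'⟩ := (hp3.and (mem_nhdsWithin_of_mem_nhds hp2)).exists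
  have hinjOn : Set.InjOn Prod.fst (Z' : Set ((Fin r → ℝ) × ℝ)) := by
    intro a ha b hb hab
    have h1 := congrArg Prod.snd (hZ' a ha).2.1
    have h2 := congrArg Prod.snd (hZ' b hb).2.1
    exact Prod.ext hab (h1.trans h2.symm)
  have hcard : (Z'.image Prod.fst).card = Z.card := by
    rw [Finset.card_image_of_injOn hinjOn, hZc, Finset.card_map]
  rw [← hcard]
  apply hT s hs _ hcard
  intro z hz l
  obtain ⟨q, hq, rfl⟩ := Finset.mem_image.mp hz
  have h1 := (hZ' q hq).2.1
  have h2 : q.2 = s := congrArg Prod.snd h1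
  have h3 : F q.1 - q.2 • pw q.1 = 0 := congrArg Prod.fst h1
  have h4 := congrFun h3 l
  simp only [Pi.sub_apply, Pi.smul_apply, smul_eq_mul, Pi.zero_apply, pw, h2] at h4
  rw [← hf]; linarith

theorem base_zero (n r : ℕ) : Bounds n r r (∏ l ∈ Finset.range r, (n * 2 ^ l : ℝ)) := by
  intro u0 u F hS Z hZ
  have := bezout (fun l : Fin r => n * 2 ^ l.val) F (fun l => hS.poly l l.2) Z (fun z hz => (hZ z hz).2)
  rw [Fin.prod_univ_eq_prod_range (fun l => n * 2 ^ l) r] at this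
  exact_mod_cast this

end Gale


namespace Gale
open Set Filter Topology MeasureTheory

theorem rolle {I : Set ℝ} (hI : I.OrdConnected) (f f' : ℝ → ℝ) (hf : ∀ x ∈ I, HasDerivAt f (f' x) x)
    (Z : Finset ℝ) (hZ : ∀ z ∈ Z, z ∈ I ∧ f z = 0) :
    ∃ Z' : Finset ℝ, (∀ z ∈ Z', z ∈ I ∧ f' z = 0) ∧ Z.card ≤ Z'.card + 1 := by
  classical
  rcases Nat.eq_zero_or_pos Z.card with h0 | h0
  · exact ⟨∅, by simp, by omega⟩
  obtain ⟨N, hN⟩ : ∃ N, Z.card = N + 1 := ⟨Z.card - 1, by omega⟩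
  let e := Z.orderEmbOfFin hN
  have he : ∀ i, e i ∈ Z := fun i => Finset.orderEmbOfFin_mem Z hN i
  have hex : ∀ i : Fin N, ∃ c, e i.castSucc < c ∧ c < e i.succ ∧ f' c = 0 := by
    intro i
    have hlt : e i.castSucc < e i.succ := e.strictMono (Fin.castSucc_lt_succ (i := i))
    have hsub : Icc (e i.castSucc) (e i.succ) ⊆ I := hI.out (hZ _ (he _)).1 (hZ _ (he _)).1
    obtain ⟨c, hc, hc2⟩ := exists_hasDerivAt_eq_zero (f := f) (f' := f') hlt
      (fun x hx => (hf x (hsub hx)).continuousAt.continuousWithinAt)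
      (by rw [(hZ _ (he _)).2, (hZ _ (he _)).2])
      (fun x hx => hf x (hsub (Ioo_subset_Icc_self hx)))
    exact ⟨c, hc.1, hc.2, hc2⟩
  choose c hc1 hc2 hc3 using hex
  have hmono : StrictMono c := by
    intro i i' hii
    have h1 : e i.succ ≤ e i'.castSucc := e.monotone (by
      rw [Fin.le_def]; simp; exact hii)
    linarith [hc2 i, hc1 i']
  refine ⟨Finset.univ.image c, ?_, ?_⟩
  · intro z hz
    obtain ⟨i, -, rfl⟩ := Finset.mem_image.mp hz
    exact ⟨hI.out (hZ _ (he i.castSucc)).1 (hZ _ (he i.succ)).1 ⟨(hc1 i).le, (hc2 i).le⟩, hc3 i⟩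
  · rw [Finset.card_image_of_injective _ hmono.injective]; simp [hN]

theorem exp_sum {ι : Type*} [DecidableEq ι] (v : ι → ℝ) (k : ℕ) : ∀ (s : Finset ι) (_ : s.card = k) (c : ι → ℝ)
    (_ : ∃ t, ∑ i ∈ s, c i * Real.exp (v i * t) ≠ 0) (Z : Finset ℝ)
    (_ : ∀ t ∈ Z, ∑ i ∈ s, c i * Real.exp (v i * t) = 0), Z.card + 1 ≤ s.card := by
  induction k with
  | zero =>
    intro s hs c ⟨t, ht⟩ Z hZ
    rw [Finset.card_eq_zero] at hs
    subst hs; simp at ht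
  | succ k ih =>
    intro s hs c ⟨t, ht⟩ Z hZ
    obtain ⟨i0, hi0⟩ : s.Nonempty := Finset.card_pos.mp (by omega)
    let g : ℝ → ℝ := fun t => ∑ i ∈ s, c i * Real.exp ((v i - v i0) * t)
    let g' : ℝ → ℝ := fun t => ∑ i ∈ s, c i * (v i - v i0) * Real.exp ((v i - v i0) * t)
    have hg : ∀ t, HasDerivAt g (g' t) t := by
      intro t
      apply HasDerivAt.fun_sum
      intro i _
      have h1 : HasDerivAt (fun t => (v i - v i0) * t) (v i - v i0) t := by
        simpa using (hasDerivAt_id t).const_mul (v i - v i0)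
      have := (h1.exp).const_mul (c i)
      exact this.congr_deriv (by ring)
    have hgf : ∀ t, g t = Real.exp (- v i0 * t) * ∑ i ∈ s, c i * Real.exp (v i * t) := by
      intro t
      rw [Finset.mul_sum]
      refine Finset.sum_congr rfl fun i _ => ?_
      rw [show (v i - v i0) * t = - v i0 * t + v i * t by ring, Real.exp_add]; ring
    have hgf' : ∀ t, g' t = Real.exp (- v i0 * t) * ∑ i ∈ s.erase i0, (c i * (v i - v i0)) * Real.exp (v i * t) := by
      intro t
      simp only [g']
      rw [← Finset.add_sum_erase s _ hi0, Finset.mul_sum, sub_self, mul_zero, zero_mul, zero_add]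
      refine Finset.sum_congr rfl fun i _ => ?_
      rw [show (v i - v i0) * t = - v i0 * t + v i * t by ring, Real.exp_add]; ring
    by_cases hz : ∃ t, ∑ i ∈ s.erase i0, (c i * (v i - v i0)) * Real.exp (v i * t) ≠ 0
    · obtain ⟨Z', hZ', hcard⟩ := rolle ordConnected_univ g g' (fun x _ => hg x) Z (fun z hzZ => ⟨mem_univ _, by
        rw [hgf, hZ z hzZ, mul_zero]⟩)
      have := ih (s.erase i0) (by rw [Finset.card_erase_of_mem hi0]; omega) _ hz Z' (fun t htZ => by
        have h1 := (hZ' t htZ).2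
        rw [hgf'] at h1
        exact (mul_eq_zero.mp h1).resolve_left (Real.exp_pos _).ne')
      rw [Finset.card_erase_of_mem hi0] at this
      omega
    · push Not at hz
      have hconst : ∀ x y, g x = g y := is_const_of_deriv_eq_zero (fun x => (hg x).differentiableAt)
        (fun x => by rw [(hg x).deriv, hgf', hz, mul_zero])
      have hZe : Z = ∅ := by
        rw [Finset.eq_empty_iff_forall_notMem]
        intro t' ht'
        have h1 := hconst t t'
        rw [hgf, hgf, hZ t' ht', mul_zero] at h1
        exact ht ((mul_eq_zero.mp h1).resolve_left (Real.exp_pos _).ne')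
      subst hZe; simp only [Finset.card_empty]; omega

theorem base_one (n : ℕ) (hn : 1 ≤ n) : Bounds n 1 0 (n + 1) := by
  classical
  intro u0 u F hS Z hZ
  rcases Z.eq_empty_or_nonempty with rfl | ⟨z0, hz0⟩
  · simp; positivity
  obtain ⟨Q, ⟨P, hPd, hPQ⟩, hQJ⟩ := exists_Q hn (by omega : 0 ≤ 1) hS
  let γ : ℝ → (Fin 1 → ℝ) := fun x _ => x
  have hγ : ∀ z : Fin 1 → ℝ, γ (z 0) = z := fun z => by funext i; rw [Subsingleton.elim i 0]
  let I : Set ℝ := {x | γ x ∈ Dom u0 u}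
  have hI : I.OrdConnected := by
    refine ⟨fun x hx y hy z hz i => ?_⟩
    have h1 := hx i
    have h2 := hy i
    simp only [aff, γ, Finset.univ_unique, Finset.sum_singleton] at h1 h2 ⊢
    rcases le_total 0 (u i default) with h | h
    · nlinarith [hz.1]
    · nlinarith [hz.2]
  have hd : ∀ x ∈ I, HasDerivAt (fun x => F (γ x) 0) (fderiv ℝ F (γ x) (fun _ => 1) 0) x := by
    intro x hx
    have h1 : HasFDerivAt F (fderiv ℝ F (γ x)) (γ x) :=
      ((hS.contDiffAt (γ x) hx (N := 1)).differentiableAt one_ne_zero).hasFDerivAt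
    have h2 : HasDerivAt γ (fun _ => 1) x := by
      rw [hasDerivAt_pi]; intro i; exact hasDerivAt_id x
    have h3 := h1.comp_hasDerivAt x h2
    exact (hasDerivAt_pi.mp h3) 0
  have hcZ : (Z.image (fun z => z 0)).card = Z.card := Finset.card_image_of_injective _ (fun a b h => by
    rw [← hγ a, ← hγ b]; exact congrArg γ h)
  obtain ⟨Z', hZ', hc⟩ := rolle hI _ _ hd (Z.image (fun z => z 0)) (by
    intro x hx
    obtain ⟨z, hz, rfl⟩ := Finset.mem_image.mp hx
    simp only [I, Set.mem_ofPred_eq, hγ]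
    exact ⟨(hZ z hz).1, by rw [(hZ z hz).2.1]; rfl⟩)
  rw [hcZ] at hc
  -- Polynomial
  let p : Polynomial ℝ := MvPolynomial.aeval (fun _ => Polynomial.X) P
  have hpd : p.natDegree ≤ n := by
    have := MvPolynomial.aeval_natDegree_le P hPd (fun _ => (Polynomial.X : Polynomial ℝ)) (n := 1) (by simp)
    simpa using this
  have hpe : ∀ x, p.eval x = Q (γ x) := by
    intro x
    rw [hPQ]
    simp only [p]
    rw [← Polynomial.coe_aeval_eq_eval, ← AlgHom.comp_apply, MvPolynomial.comp_aeval, MvPolynomial.aeval_eq_eval]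
    simp [γ]
  have hp0 : p ≠ 0 := by
    intro h
    have h1 := (hQJ z0 (hZ z0 hz0).1).mpr (hZ z0 hz0).2.2
    rw [← hγ z0, ← hpe, h] at h1
    simp at h1
  have hsub : Z' ⊆ p.roots.toFinset := by
    intro x hx
    rw [Multiset.mem_toFinset, Polynomial.mem_roots hp0, Polynomial.IsRoot.def, hpe]
    by_contra hne
    obtain ⟨hxI, hx0⟩ := hZ' x hx
    have hinj := (hQJ (γ x) hxI).mp hne
    have : (fun _ => 1 : Fin 1 → ℝ) = 0 := (injective_iff_map_eq_zero _).mp hinj _ (by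
      funext i; rw [Subsingleton.elim i 0]; exact hx0)
    have := congrFun this 0
    simp at this
  have h1 := Finset.card_le_card hsub
  have h2 := (Multiset.toFinset_card_le p.roots).trans (p.card_roots'.trans hpd)
  have : Z.card ≤ n + 1 := by omega
  exact_mod_cast this

end Gale


namespace Gale
open Set Filter Topology MeasureTheory

theorem excess_one (κ : ℕ) : Bounds 1 κ 0 (κ + 1) := by
  classical
  intro u0 u F hS Z hZ
  rcases Z.eq_empty_or_nonempty with rfl | ⟨z0, hz0⟩
  · simp; positivity
  obtain ⟨hD0, hF0, hi0⟩ := hZ z0 hz0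
  have hlog := fun l => hS.log l (Nat.zero_le _)
  choose e c hec using hlog
  let U : (Fin κ → ℝ) →ₗ[ℝ] (Fin (1 + κ) → ℝ) := Matrix.mulVecLin (Matrix.of u)
  have hU : ∀ v i, U v i = ∑ l, u i l * v l := fun v i => by simp [U, Matrix.mulVec, dotProduct]
  let T : (Fin (1 + κ) → ℝ) →ₗ[ℝ] (Fin κ → ℝ) := Matrix.mulVecLin (Matrix.of e)
  have hT : ∀ X l, T X l = ∑ i, e l i * X i := fun v i => by simp [T, Matrix.mulVec, dotProduct]
  have hUi : Function.Injective U := (injective_iff_map_eq_zero _).mpr fun v hv => hS.inj v fun i => by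
    rw [← hU, hv]; rfl
  have haff : ∀ z i, aff u0 u i z = u0 i + U z i := fun z i => by rw [hU]; rfl
  have hTs : Function.Surjective T := by
    intro w
    obtain ⟨v, hv⟩ := (LinearMap.injective_iff_surjective 
      (f := (fderiv ℝ F z0 : (Fin κ → ℝ) →ₗ[ℝ] (Fin κ → ℝ)))).mp hi0 w
    simp only [ContinuousLinearMap.coe_coe] at hv
    refine ⟨fun i => U v i / aff u0 u i z0, ?_⟩
    have hd : DifferentiableAt ℝ F z0 := (hS.contDiffAt z0 hD0 (N := 1)).differentiableAt one_ne_zero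
    funext l
    rw [← hv, fderiv_comp_apply hd, fderiv_log_row (hec l) z0 v hD0, hT]
    refine Finset.sum_congr rfl fun i _ => ?_
    rw [hU]; ring
  have hk1 : Module.finrank ℝ (LinearMap.ker T) = 1 := by
    have h1 := LinearMap.finrank_range_add_finrank_ker T
    rw [LinearMap.range_eq_top.mpr hTs, finrank_top] at h1
    simp at h1
    omega
  obtain ⟨v0, hv0, hspan⟩ := finrank_eq_one_iff'.mp hk1
  set v : Fin (1 + κ) → ℝ := v0.1 with hv
  have hvne : v ≠ 0 := fun h => hv0 (Subtype.ext h)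
  have hTv : T v = 0 := v0.2
  have hker : ∀ X, T X = 0 → ∃ t : ℝ, X = t • v := by
    intro X hX
    obtain ⟨t, ht⟩ := hspan ⟨X, hX⟩
    exact ⟨t, (congrArg Subtype.val ht).symm⟩
  have hUrank : Module.finrank ℝ (LinearMap.range U) = κ := by
    rw [LinearMap.finrank_range_of_inj hUi]; simp
  have hUlt : LinearMap.range U < ⊤ := by
    rw [lt_top_iff_ne_top]
    intro h
    rw [h, finrank_top] at hUrank
    simp at hUrank
  obtain ⟨f, hf0, hfU⟩ := Submodule.exists_le_ker_of_lt_top _ hUlt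
  have hfker : LinearMap.range U = LinearMap.ker f := by
    apply Submodule.eq_of_le_of_finrank_eq hfU
    have := Module.Dual.finrank_ker_add_one_of_ne_zero hf0
    simp at this
    omega
  let φ : Fin (1 + κ) → ℝ := fun i => f (fun j => if i = j then 1 else 0)
  have hφ : ∀ X, f X = ∑ i, X i * φ i := fun X => by
    rw [LinearMap.pi_apply_eq_sum_univ f X]; rfl
  have hT1 : ∀ z ∈ Dom u0 u, F z = 0 → T (fun i => Real.log (aff u0 u i z)) = c := by
    intro z hz hFz
    funext l
    have h1 := hec l z hz
    rw [hFz] at h1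
    rw [hT]
    unfold lg at h1
    simp only [Pi.zero_apply] at h1
    linarith
  have hex : ∀ z : Fin κ → ℝ, ∃ t : ℝ, z ∈ Z → ∀ i, aff u0 u i z = aff u0 u i z0 * Real.exp (v i * t) := by
    intro z
    by_cases hz : z ∈ Z
    · obtain ⟨hD, hFz, -⟩ := hZ z hz
      obtain ⟨t, ht⟩ := hker ((fun i => Real.log (aff u0 u i z)) - fun i => Real.log (aff u0 u i z0)) (by
        rw [map_sub, hT1 z hD hFz, hT1 z0 hD0 hF0, sub_self])
      refine ⟨t, fun _ i => ?_⟩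
      have h1 := congrFun ht i
      simp only [Pi.sub_apply, Pi.smul_apply, smul_eq_mul] at h1
      rw [← Real.exp_log (hD i), ← Real.exp_log (hD0 i), ← Real.exp_add]
      congr 1
      linarith
    · exact ⟨0, fun h => absurd h hz⟩
  choose t ht using hex
  let V : Option (Fin (1 + κ)) → ℝ := fun o => o.elim 0 v
  let C : Option (Fin (1 + κ)) → ℝ := fun o => o.elim (- f u0) (fun i => φ i * aff u0 u i z0)
  have hsum : ∀ s, ∑ o, C o * Real.exp (V o * s) = f ((fun i => aff u0 u i z0 * Real.exp (v i * s)) - u0) := by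
    intro s
    rw [Fintype.sum_option, map_sub, hφ (fun i => aff u0 u i z0 * Real.exp (v i * s))]
    simp only [C, V, Option.elim]
    rw [zero_mul, Real.exp_zero, mul_one, add_comm, sub_eq_add_neg]
    congr 1
    exact Finset.sum_congr rfl fun i _ => by ring
  have hne : ∃ s, ∑ o, C o * Real.exp (V o * s) ≠ 0 := by
    by_contra hcon
    push Not at hcon
    obtain ⟨G, hG⟩ := LinearMap.exists_leftInverse_of_injective U (LinearMap.ker_eq_bot.mpr hUi)
    let y : ℝ → (Fin κ → ℝ) := fun s => G ((fun i => aff u0 u i z0 * Real.exp (v i * s)) - u0)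
    have hUy : ∀ s, U (y s) = (fun i => aff u0 u i z0 * Real.exp (v i * s)) - u0 := by
      intro s
      have h1 : (fun i => aff u0 u i z0 * Real.exp (v i * s)) - u0 ∈ LinearMap.range U := by
        rw [hfker, LinearMap.mem_ker, ← hsum, hcon]
      obtain ⟨x, hx⟩ := h1
      have h2 : y s = x := by
        simp only [y]; rw [← hx]; exact LinearMap.congr_fun hG x
      rw [h2, hx]
    have hay : ∀ s i, aff u0 u i (y s) = aff u0 u i z0 * Real.exp (v i * s) := by
      intro s i
      rw [haff (y s), hUy]; simp
    have hyc : Continuous y := by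
      have hGc : Continuous G := G.continuous_of_finiteDimensional
      apply hGc.comp
      fun_prop
    have hyD : ∀ s, y s ∈ Dom u0 u := fun s i => by
      rw [hay]; exact mul_pos (hD0 i) (Real.exp_pos _)
    have hy0 : y 0 = z0 := by
      apply hUi
      rw [hUy]
      funext i
      simp [haff]
    have hFy : ∀ s, F (y s) = 0 := by
      intro s
      funext l
      rw [hec l _ (hyD s)]
      have h1 : T (fun i => Real.log (aff u0 u i (y s))) = c := by
        have h2 : (fun i => Real.log (aff u0 u i (y s))) = (fun i => Real.log (aff u0 u i z0)) + s • v := by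
          funext i
          rw [hay, Real.log_mul (hD0 i).ne' (Real.exp_pos _).ne', Real.log_exp]
          simp [mul_comm]
        rw [h2, map_add, map_smul, hTv, hT1 z0 hD0 hF0]; simp
      have h3 := congrFun h1 l
      rw [hT] at h3
      simp only [lg, Pi.zero_apply, h3, sub_self]
    obtain ⟨⟨N, hN, hNi⟩, -⟩ := local_inj (hS.contDiffAt z0 hD0) hi0
    have hev : ∀ᶠ s in 𝓝[≠] (0:ℝ), y s ∈ N := by
      apply mem_nhdsWithin_of_mem_nhds
      have := hyc.tendsto 0
      rw [hy0] at this
      exact this hN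
    obtain ⟨s, hsN, hs0⟩ := (hev.and self_mem_nhdsWithin).exists
    have h1 : y s = z0 := hNi hsN (mem_of_mem_nhds hN) (by rw [hFy, hF0])
    apply hvne
    funext i
    have h2 := hay s i
    rw [h1] at h2
    have h3 : Real.exp (v i * s) = 1 := by
      have := (hD0 i).ne'
      field_simp at h2
      exact h2.symm
    rw [Real.exp_eq_one_iff] at h3
    exact (mul_eq_zero.mp h3).resolve_right hs0
  have hfin := exp_sum V _ Finset.univ rfl C hne (Z.image t) (by
    intro s hs
    obtain ⟨z, hz, rfl⟩ := Finset.mem_image.mp hs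
    rw [hsum]
    have h1 : (fun i => aff u0 u i z0 * Real.exp (v i * t z)) - u0 = U z := by
      funext i
      rw [Pi.sub_apply, ← ht z hz i, haff]; ring
    rw [h1, ← LinearMap.mem_ker, ← hfker]
    exact ⟨z, rfl⟩)
  rw [Finset.card_image_of_injOn] at hfin
  · simp at hfin
    have : Z.card ≤ κ + 1 := by omega
    exact_mod_cast this
  · intro z hz z' hz' hzz
    apply hUi
    funext i
    have h1 := ht z hz i
    have h2 := ht z' hz' i
    rw [hzz, ← h2, haff, haff] at h1
    linarith

end Gale


namespace Gale
open Set Filter Topology MeasureTheory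

noncomputable def BB (n : ℕ) : ℕ → ℕ → ℝ
  | 0, r => ∏ l ∈ Finset.range r, (n * 2 ^ l : ℝ)
  | lam + 1, r => if lam = 0 ∧ r = 0 then (n : ℝ) + 1 else BB n lam (r + 1) + (n + r + 2) / 2 * BB n lam r

theorem BB_nonneg (n lam : ℕ) : ∀ r, 0 ≤ BB n lam r := by
  induction lam with
  | zero => intro r; unfold BB; positivity
  | succ lam ih =>
    intro r
    unfold BB
    split_ifs
    · positivity
    · have := ih (r+1)
      have := ih r
      positivity

theorem main_bounds (n : ℕ) (hn : 1 ≤ n) (lam : ℕ) : ∀ r, Bounds n (lam + r) r (BB n lam r) := by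
  induction lam with
  | zero =>
    intro r
    rw [zero_add]; unfold BB
    exact base_zero n r
  | succ lam ih =>
    intro r
    unfold BB
    split_ifs with h
    · obtain ⟨rfl, rfl⟩ := h
      exact base_one n hn
    · have h1 : lam + 1 + r = (lam + r) + 1 := by omega
      rw [h1]
      exact sys_step (k := lam + r) hn ⟨r, by omega⟩ _ _ (BB_nonneg n lam r) (BB_nonneg n lam (r+1)) (ih (r+1)) (ih r)

noncomputable def beta : ℕ → ℕ → ℝ
  | 0, _ => 1
  | lam + 1, r => if lam = 0 ∧ r = 0 then 3 / 2 else beta lam (r + 1) + (r + 4) / 4 / 2 ^ (lam + r) * beta lam r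

theorem beta_nonneg (lam : ℕ) : ∀ r, 0 ≤ beta lam r := by
  induction lam with
  | zero => intro r; unfold beta; positivity
  | succ lam ih =>
    intro r
    unfold beta
    split_ifs
    · positivity
    · have := ih (r+1)
      have := ih r
      positivity

theorem BB_le (n : ℕ) (hn : 2 ≤ n) (lam : ℕ) : ∀ r, BB n lam r ≤ beta lam r * ∏ l ∈ Finset.range (lam + r), (n * 2 ^ l : ℝ) := by
  have hn' : (2:ℝ) ≤ n := by exact_mod_cast hn
  induction lam with
  | zero => intro r; unfold BB beta; simp
  | succ lam ih =>
    intro r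
    unfold BB beta
    split_ifs with h
    · obtain ⟨rfl, rfl⟩ := h
      simp; linarith
    · have h1 : lam + 1 + r = (lam + r) + 1 := by omega
      have i1 := ih (r+1)
      have i2 := ih r
      rw [← add_assoc] at i1
      rw [h1, add_mul]
      refine add_le_add i1 ?_
      rw [Finset.prod_range_succ]
      set D := ∏ l ∈ Finset.range (lam + r), (n * 2 ^ l : ℝ) with hD
      have hD0 : 0 ≤ D := by positivity
      have hb := beta_nonneg lam r
      have e1 : (r + 4) / 4 / 2 ^ (lam + r) * beta lam r * (D * (n * 2 ^ (lam + r))) = ((r + 4) / 4 * n) * (beta lam r * D) := by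
        field_simp
      rw [e1]
      have e2 : ((n : ℝ) + r + 2) / 2 ≤ (r + 4) / 4 * n := by
        have hr : (0:ℝ) ≤ r := by positivity
        nlinarith
      have e3 : 0 ≤ ((n : ℝ) + r + 2) / 2 := by positivity
      calc ((n : ℝ) + r + 2) / 2 * BB n lam r ≤ ((n : ℝ) + r + 2) / 2 * (beta lam r * D) := by gcongr
        _ ≤ _ := by gcongr

theorem beta_step (K : ℕ) (hK : 1 ≤ K) (M : ℝ) (h : ∀ lam r, lam + r = K → beta lam r ≤ M) (lam : ℕ) :
    ∀ r, lam + r = K + 1 → beta lam r ≤ 1 + M * (lam * ((K + 4) / 4 / 2 ^ K)) := by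
  induction lam with
  | zero => intro r _; unfold beta; simp
  | succ lam ih =>
    intro r hr
    unfold beta
    rw [if_neg (by omega)]
    have hK2 : lam + r = K := by omega
    have h1 := ih (r+1) (by omega)
    have h2 := h lam r hK2
    have h0 := beta_nonneg lam r
    rw [hK2]
    have hrK : (r : ℝ) ≤ K := by
      have : r ≤ K := by omega
      exact_mod_cast this
    have h3 : ((r : ℝ) + 4) / 4 / 2 ^ K * beta lam r ≤ (K + 4) / 4 / 2 ^ K * M := by gcongr
    push_cast
    nlinarith

theorem num_aux (K : ℕ) (hK : 5 ≤ K) : (K + 1) * (K + 4) * 100 ≤ 172 * 2 ^ K := by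
  induction K, hK using Nat.le_induction with
  | base => norm_num
  | succ K hK ih => rw [pow_succ]; nlinarith

theorem beta_all (K : ℕ) (hK : 5 ≤ K) : ∀ lam r, lam + r = K → beta lam r ≤ 12 / 5 := by
  induction K, hK using Nat.le_induction with
  | base =>
    intro lam r h
    have h4 : ∀ lam r, lam + r = 4 → beta lam r ≤ 21 / 10 := by
      intro lam r h
      have hl : lam ≤ 4 := by omega
      interval_cases lam
      · obtain rfl : r = 4 := by omega
        simp only [beta]; norm_num
      · obtain rfl : r = 3 := by omega
        simp only [beta]; norm_num
      · obtain rfl : r = 2 := by omega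
        simp only [beta]; norm_num
      · obtain rfl : r = 1 := by omega
        simp only [beta]; norm_num
      · obtain rfl : r = 0 := by omega
        simp only [beta]; norm_num
    have h5 := beta_step 4 (by norm_num) _ h4 lam r h
    have h6 : (lam : ℝ) ≤ 5 := by
      have : lam ≤ 5 := by omega
      exact_mod_cast this
    norm_num at h5
    linarith
  | succ K hK ih =>
    intro lam r h
    have h5 := beta_step K (by omega) _ ih lam r h
    have h6 : (lam : ℝ) ≤ K + 1 := by
      have : lam ≤ K + 1 := by omega
      exact_mod_cast this
    have h7 : ((K : ℝ) + 1) * ((K + 4) / 4 / 2 ^ K) ≤ 43 / 100 := by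
      have h8 : ((K : ℝ) + 1) * (K + 4) * 100 ≤ 172 * 2 ^ K := by exact_mod_cast num_aux K hK
      have h9 : ((K : ℝ) + 1) * ((K + 4) / 4 / 2 ^ K) = ((K : ℝ) + 1) * (K + 4) / (4 * 2 ^ K) := by field_simp
      rw [h9, div_le_iff₀ (by positivity)]
      linarith
    have h8 : (lam : ℝ) * ((K + 4) / 4 / 2 ^ K) ≤ (K + 1) * ((K + 4) / 4 / 2 ^ K) := by gcongr
    linarith

theorem beta_zero (j : ℕ) (hj : 2 ≤ j) : beta j 0 ≤ 5 / 2 := by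
  rcases Nat.lt_or_ge j 5 with h | h
  · interval_cases j
    · simp only [beta]; norm_num
    · simp only [beta]; norm_num
    · simp only [beta]; norm_num
  · exact (beta_all j h j 0 rfl).trans (by norm_num)

theorem const_gt : 5 / 2 < ((Real.exp 1) ^ 2 + 3) / 4 := by
  have := Real.exp_one_gt_d9
  nlinarith

theorem prod_D (n j : ℕ) : ∏ l ∈ Finset.range j, (n * 2 ^ l : ℝ) = 2 ^ (j * (j - 1) / 2) * (n : ℝ) ^ j := by
  rw [Finset.prod_mul_distrib, Finset.prod_pow_eq_pow_sum, Finset.sum_range_id, Finset.prod_const, Finset.card_range, mul_comm]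

theorem one_num (j : ℕ) (hj : 2 ≤ j) : ((j : ℝ) + 1) < 5 / 2 * 2 ^ (j * (j - 1) / 2) := by
  have h1 : j - 1 ≤ j * (j - 1) / 2 := by
    rw [Nat.le_div_iff_mul_le (by norm_num), mul_comm]
    exact Nat.mul_le_mul_right _ hj
  have h2 : (2:ℝ) ^ (j - 1) ≤ 2 ^ (j * (j - 1) / 2) := pow_le_pow_right₀ (by norm_num) h1
  have h3 : j ≤ 2 ^ (j - 1) := by
    have := (j - 1).lt_two_pow_self
    omega
  have h4 : (j : ℝ) ≤ 2 ^ (j - 1) := by exact_mod_cast h3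
  have h5 : (2 : ℝ) ≤ j := by exact_mod_cast hj
  linarith

theorem final_bound (m j : ℕ) (hm : 1 ≤ m) (hj : 2 ≤ j) : ∃ N : ℝ, Bounds m j 0 N ∧
    N < ((Real.exp 1) ^ 2 + 3) / 4 * (2 : ℝ) ^ (j * (j - 1) / 2) * (m : ℝ) ^ j := by
  have hc := const_gt
  rcases Nat.lt_or_ge m 2 with h | h
  · obtain rfl : m = 1 := by omega
    refine ⟨_, excess_one j, ?_⟩
    have h1 := one_num j hj
    have h2 : (0:ℝ) < 2 ^ (j * (j - 1) / 2) := by positivity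
    simp only [Nat.cast_one, one_pow, mul_one]
    nlinarith
  · refine ⟨BB m j 0, main_bounds m hm j 0, ?_⟩
    have h1 := BB_le m h j 0
    rw [add_zero, prod_D] at h1
    have h2 : (0:ℝ) < 2 ^ (j * (j - 1) / 2) * (m : ℝ) ^ j := by
      have : (0:ℝ) < m := by exact_mod_cast hm
      positivity
    have h3 := beta_zero j hj
    rw [mul_assoc]
    nlinarith

end Gale

namespace Gale
open Set Filter Topology MeasureTheory

theorem H_eq {N κ : ℕ} (u0 : Fin N → ℝ) (u : Fin N → Fin κ → ℝ) (e : Fin N → ℝ) (y : Fin κ → ℝ) (hy : y ∈ Dom u0 u) :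
    ∏ i, (u0 i + ∑ l, u i l * y l) ^ (e i) = Real.exp (lg u0 u e y) := by
  unfold lg
  rw [Real.exp_sum]
  refine Finset.prod_congr rfl fun i _ => ?_
  have h : 0 < u0 i + ∑ l, u i l * y l := hy i
  rw [Real.rpow_def_of_pos h, mul_comm]; rfl

theorem final_aux (m j : ℕ) (E : Matrix (Fin (m + j)) (Fin j) ℝ)
    (u0 : Fin (m + j) → ℝ) (u : Fin (m + j) → Fin j → ℝ) (z : Fin j → ℝ) (hz : z ∈ Dom u0 u)
    (h0 : (fun y => fun ℓ => (∏ i, (u0 i + ∑ l, u i l * y l) ^ (E i ℓ)) - 1 : (Fin j → ℝ) → (Fin j → ℝ)) z = 0)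
    (hb : Function.Bijective (fderiv ℝ (fun y => fun ℓ => (∏ i, (u0 i + ∑ l, u i l * y l) ^ (E i ℓ)) - 1 : (Fin j → ℝ) → (Fin j → ℝ)) z)) :
    (fun y ℓ => lg u0 u (fun i => E i ℓ) y) z = 0 ∧
      Function.Injective (fderiv ℝ (fun y ℓ => lg u0 u (fun i => E i ℓ) y) z) := by
  set F : (Fin j → ℝ) → (Fin j → ℝ) := fun y ℓ => lg u0 u (fun i => E i ℓ) y with hF
  set H : (Fin j → ℝ) → (Fin j → ℝ) := fun y => fun ℓ => (∏ i, (u0 i + ∑ l, u i l * y l) ^ (E i ℓ)) - 1 with hH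
  have hHF : ∀ y ∈ Dom u0 u, ∀ l, H y l = Real.exp (F y l) - 1 := fun y hy l => by
    simp only [hH, hF, H_eq u0 u _ y hy]
  have hFz : F z = 0 := by
    funext l
    have h1 := hHF z hz l
    rw [h0] at h1
    have h2 : Real.exp (F z l) = 1 := by simp only [Pi.zero_apply] at h1; linarith
    exact Real.exp_eq_one_iff _ |>.mp h2
  refine ⟨hFz, ?_⟩
  have hd : DifferentiableAt ℝ F z := by
    rw [differentiableAt_pi]
    intro l
    exact (contDiffAt_lg u0 u _ z hz (n := 1)).differentiableAt one_ne_zero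
  have hHd : HasFDerivAt H (fderiv ℝ F z) z := by
    rw [hasFDerivAt_pi']
    intro l
    have h1 : HasFDerivAt (fun y => F y l) ((ContinuousLinearMap.proj l).comp (fderiv ℝ F z)) z :=
      (hasFDerivAt_pi'.mp hd.hasFDerivAt) l
    have h2 := (h1.exp).sub_const 1
    rw [hFz] at h2
    simp only [Pi.zero_apply, Real.exp_zero, one_smul] at h2
    apply h2.congr_of_eventuallyEq
    filter_upwards [(isOpen_Dom u0 u).mem_nhds hz] with y hy using hHF y hy l
  rw [hHd.fderiv] at hb
  exact hb.1

end Gale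

theorem stmt9 (m j : ℕ) (hm : 1 ≤ m) (hj : 2 ≤ j)
    (E : Matrix (Fin (m + j)) (Fin j) ℝ)
    (u0 : Fin (m + j) → ℝ) (u : Fin (m + j) → Fin j → ℝ)
    (Δ : Set (Fin j → ℝ))
    (hΔ : Δ = {y : Fin j → ℝ | ∀ i, 0 < u0 i + ∑ l, u i l * y l})
    (H : (Fin j → ℝ) → (Fin j → ℝ))
    (hH : H = fun y => fun ℓ =>
      (∏ i, (u0 i + ∑ l, u i l * y l) ^ (E i ℓ)) - 1) :
    {y : Fin j → ℝ | y ∈ Δ ∧ H y = 0 ∧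
        Function.Bijective (fderiv ℝ H y)}.Finite ∧
      ({y : Fin j → ℝ | y ∈ Δ ∧ H y = 0 ∧
        Function.Bijective (fderiv ℝ H y)}.ncard : ℝ) < S m j := by
  classical
  have hΔ' : Δ = Gale.Dom u0 u := hΔ
  subst hΔ'
  clear hΔ
  subst hH
  obtain ⟨N, hN, hNS⟩ := Gale.final_bound m j hm hj
  have hSeq : S m j = ((Real.exp 1) ^ 2 + 3) / 4 * (2 : ℝ) ^ (j * (j - 1) / 2) * (m : ℝ) ^ j := by
    unfold S
    rw [if_neg (by omega), if_neg (by omega)]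
  rw [hSeq]
  set H : (Fin j → ℝ) → (Fin j → ℝ) := fun y => fun ℓ =>
      (∏ i, (u0 i + ∑ l, u i l * y l) ^ (E i ℓ)) - 1 with hH
  set A := {y : Fin j → ℝ | y ∈ Gale.Dom u0 u ∧ H y = 0 ∧ Function.Bijective (fderiv ℝ H y)} with hA
  rcases A.eq_empty_or_nonempty with h0 | ⟨z0, hz0⟩
  · rw [h0]
    refine ⟨Set.finite_empty, ?_⟩
    simp only [Set.ncard_empty, Nat.cast_zero]
    have : (0:ℝ) < m := by exact_mod_cast hm
    positivity
  have hsys : Gale.IsSys m j 0 u0 u (fun y ℓ => Gale.lg u0 u (fun i => E i ℓ) y) := by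
    refine ⟨?_, fun l hl => absurd hl (by omega), fun l _ => ⟨fun i => E i l, 0, fun y _ => by simp⟩⟩
    intro v hv
    have h1 := (Gale.final_aux m j E u0 u z0 hz0.1 hz0.2.1 hz0.2.2).2
    apply (injective_iff_map_eq_zero _).mp h1
    have hd : DifferentiableAt ℝ (fun y ℓ => Gale.lg u0 u (fun i => E i ℓ) y) z0 := by
      rw [differentiableAt_pi]
      intro l
      exact (Gale.contDiffAt_lg u0 u _ z0 hz0.1 (n := 1)).differentiableAt one_ne_zero
    funext l
    rw [Gale.fderiv_comp_apply hd,
      Gale.fderiv_log_row (e := fun i => E i l) (c := 0) (fun y _ => by simp) z0 v hz0.1]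
    simp [hv]
  have hbd : ∀ Y : Finset (Fin j → ℝ), (∀ x ∈ Y, x ∈ A) → (Y.card : ℝ) ≤ N := by
    intro Y hY
    refine hN u0 u _ hsys Y fun z hz => ?_
    have hzA := hY z hz
    exact ⟨hzA.1, Gale.final_aux m j E u0 u z hzA.1 hzA.2.1 hzA.2.2⟩
  have hfin : A.Finite := Gale.finite_of_bdd A N hbd
  refine ⟨hfin, lt_of_le_of_lt ?_ hNS⟩
  rw [Set.ncard_eq_toFinset_card A hfin]
  exact hbd _ (fun x hx => by simpa using hx)
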